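/- arXiv:2110.14178 — 2 statements merged into one kernel-verified Lean document; each statement's English description precedes it below -/
import Mathlib

section
/- Assume GRH for χ, i.e. every zero s of L(s,χ) with 0 < Re(s) < 1 satisfies Re(s) = 1/2. Then for every ε > 0 there exists T₀ ≥ 4 such that for every s = σ + it with σ ≥ 1 and t ≥ T₀, one has |L(s,χ)| ≤ (2·e^{C₀}·φ(q)/q + ε)·log(log t). In particular limsup_{t→∞} |L(σ+it,χ)|/log log t ≤ 2e^{C₀}φ(q)/q uniformly for σ ≥ 1. -/
open Complex DirichletCharacter Finset

section LogLFunction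

open Filter Topology Set MeasureTheory ArithmeticFunction

/-- The coefficients `χ(n) Λ(n) / log n` of the Dirichlet series of `log L(s, χ)`. -/
noncomputable def logCoeff {q : ℕ} (χ : DirichletCharacter ℂ q) (n : ℕ) : ℂ :=
  χ n * ((Λ n / Real.log n : ℝ) : ℂ)

lemma vonMangoldt_div_log_nonneg (n : ℕ) : 0 ≤ Λ n / Real.log n :=
  div_nonneg vonMangoldt_nonneg (Real.log_natCast_nonneg n)

lemma vonMangoldt_div_log_le_one (n : ℕ) : Λ n / Real.log n ≤ 1 :=
  div_le_one_of_le₀ vonMangoldt_le_log (Real.log_natCast_nonneg n)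

lemma norm_logCoeff_le {q : ℕ} (χ : DirichletCharacter ℂ q) (n : ℕ) :
    ‖logCoeff χ n‖ ≤ Λ n / Real.log n := by
  rw [logCoeff, norm_mul, norm_real, Real.norm_of_nonneg (vonMangoldt_div_log_nonneg n)]
  exact mul_le_of_le_one_left (vonMangoldt_div_log_nonneg n) (χ.norm_le_one _)

lemma norm_logCoeff_le_one {q : ℕ} (χ : DirichletCharacter ℂ q) (n : ℕ) :
    ‖logCoeff χ n‖ ≤ 1 :=
  (norm_logCoeff_le χ n).trans (vonMangoldt_div_log_le_one n)

lemma abscissaOfAbsConv_logCoeff_lt {q : ℕ} (χ : DirichletCharacter ℂ q) {s : ℂ} (hs : 1 < s.re) :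
    LSeries.abscissaOfAbsConv (logCoeff χ) < s.re :=
  (LSeries.abscissaOfAbsConv_le_of_le_const ⟨1, fun n _ ↦ norm_logCoeff_le_one χ n⟩).trans_lt
    (by exact_mod_cast hs)

lemma logMul_logCoeff {q : ℕ} (χ : DirichletCharacter ℂ q) :
    LSeries.logMul (logCoeff χ) = (fun n : ℕ ↦ χ n) * fun n ↦ (Λ n : ℂ) := by
  ext n
  simp only [LSeries.logMul, logCoeff, Pi.mul_apply]
  rcases le_or_gt n 1 with h | h
  · interval_cases n <;> simp
  · have : Real.log n ≠ 0 := (Real.log_pos (by exact_mod_cast h)).ne'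
    have h2 : Complex.log n ≠ 0 := by
      rw [← natCast_log]
      exact_mod_cast this
    push_cast
    field_simp

lemma isPreconnected_re_gt (a : ℝ) : IsPreconnected {s : ℂ | a < s.re} :=
  (convex_halfSpace_re_gt a).isPreconnected

lemma hasDerivAt_LSeries_logCoeff {q : ℕ} [NeZero q] (χ : DirichletCharacter ℂ q) {s : ℂ}
    (hs : 1 < s.re) :
    HasDerivAt (LSeries (logCoeff χ)) (deriv (LFunction χ) s / LFunction χ s) s := by
  convert LSeries_hasDerivAt (abscissaOfAbsConv_logCoeff_lt χ hs) using 1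
  rw [logMul_logCoeff, DirichletCharacter.LSeries_twist_vonMangoldt_eq χ hs,
    deriv_LFunction_eq_deriv_LSeries χ hs, LFunction_eq_LSeries χ hs]
  ring

/-- On the half-plane of absolute convergence, `∑ χ(n) Λ(n) / log n * n⁻ˢ` is a logarithm of
`L(s, χ)`. -/
lemma exp_LSeries_logCoeff {q : ℕ} [NeZero q] (χ : DirichletCharacter ℂ q) {s : ℂ}
    (hs : 1 < s.re) : cexp (LSeries (logCoeff χ) s) = LFunction χ s := by
  let h : ℂ → ℂ := fun z ↦ LFunction χ z * cexp (-LSeries (logCoeff χ) z)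
  have hne {z : ℂ} (hz : 1 < z.re) : LFunction χ z ≠ 0 := by
    rw [LFunction_eq_LSeries χ hz]
    exact LSeries_ne_zero_of_one_lt_re χ hz
  have hd {z : ℂ} (hz : 1 < z.re) : HasDerivAt h 0 z := by
    have h1 : HasDerivAt (LFunction χ) (deriv (LFunction χ) z) z :=
      (differentiableAt_LFunction χ z (.inl fun h ↦ by simp [h] at hz)).hasDerivAt
    have := hne hz
    refine (h1.mul (hasDerivAt_LSeries_logCoeff χ hz).fun_neg.cexp).congr_deriv ?_
    field_simp
    ring
  have hconst {z : ℂ} (hz : 1 < z.re) : h z = h s :=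
    (isOpen_re_gt 1).is_const_of_deriv_eq_zero (isPreconnected_re_gt 1)
      (fun w hw ↦ (hd hw).differentiableAt.differentiableWithinAt)
      (fun w hw ↦ (hd hw).deriv) hz hs
  have hlim : Tendsto (fun x : ℝ ↦ h x) atTop (𝓝 1) := by
    have h1 : Tendsto (fun x : ℝ ↦ LSeries (fun n : ℕ ↦ χ n) x) atTop (𝓝 (χ (1 : ℕ))) :=
      LSeries.tendsto_atTop <| (LSeries.abscissaOfAbsConv_le_of_le_const
        ⟨1, fun n _ ↦ χ.norm_le_one _⟩).trans_lt (by exact_mod_cast EReal.coe_lt_top 1)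
    have h2 : Tendsto (fun x : ℝ ↦ LSeries (logCoeff χ) x) atTop (𝓝 (logCoeff χ 1)) :=
      LSeries.tendsto_atTop <| (LSeries.abscissaOfAbsConv_le_of_le_const
        ⟨1, fun n _ ↦ norm_logCoeff_le_one χ n⟩).trans_lt (by exact_mod_cast EReal.coe_lt_top 1)
    have h3 := h1.mul (Complex.continuous_exp.continuousAt.tendsto.comp h2.neg)
    simp only [Nat.cast_one, map_one, logCoeff, vonMangoldt_apply_one, zero_div, ofReal_zero,
      mul_zero, neg_zero, Complex.exp_zero, mul_one] at h3
    refine h3.congr' ?_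
    filter_upwards [eventually_gt_atTop 1] with x hx
    simp [h, LFunction_eq_LSeries χ (s := x) (by simpa using hx)]
  have h1 : h s = 1 := by
    refine tendsto_nhds_unique (tendsto_const_nhds.congr' ?_) hlim
    filter_upwards [eventually_gt_atTop 1] with x hx
    exact (hconst (by simpa using hx)).symm
  have : LFunction χ s = LFunction χ s * cexp (-LSeries (logCoeff χ) s) *
      cexp (LSeries (logCoeff χ) s) := by
    rw [mul_assoc, ← Complex.exp_add]; simp
  rw [this, show LFunction χ s * cexp (-LSeries (logCoeff χ) s) = 1 from h1, one_mul]

lemma differentiableAt_of_exp_comp {f g : ℂ → ℂ} {z : ℂ} (hf : ContinuousAt f z)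
    (hg : DifferentiableAt ℂ g z) (h : ∀ᶠ w in 𝓝 z, cexp (f w) = g w) : DifferentiableAt ℂ f z := by
  have h0 : g z ≠ 0 := h.self_of_nhds ▸ Complex.exp_ne_zero _
  have hlog : DifferentiableAt ℂ (fun w ↦ f z + Complex.log (g w / g z)) z := by
    refine (DifferentiableAt.clog (hg.div_const _) ?_).const_add _
    rw [div_self h0]
    exact one_mem_slitPlane
  refine hlog.congr_of_eventuallyEq ?_
  have him : ∀ᶠ w in 𝓝 z, |(f w - f z).im| < Real.pi := by
    have : ContinuousAt (fun w ↦ |(f w - f z).im|) z := by fun_prop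
    exact this.eventually_lt continuousAt_const (by simpa using Real.pi_pos)
  filter_upwards [h, him] with w hw hwi
  rw [← hw, ← h.self_of_nhds, ← Complex.exp_sub, Complex.log_exp (abs_lt.1 hwi).1 (abs_lt.1 hwi).2.le]
  ring

/-- If `L(s, χ)` has no zeros with `1/2 < Re s`, then `log L(s, χ)` extends holomorphically
to this half-plane. -/
lemma exists_log_LFunction {q : ℕ} [NeZero q] {χ : DirichletCharacter ℂ q} (hχ : χ ≠ 1)
    (hne : ∀ s : ℂ, 1 / 2 < s.re → LFunction χ s ≠ 0) :
    ∃ f : ℂ → ℂ, DifferentiableOn ℂ f {s | 1 / 2 < s.re} ∧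
      (∀ s : ℂ, 1 / 2 < s.re → cexp (f s) = LFunction χ s) ∧
      ∀ s : ℂ, 1 < s.re → f s = LSeries (logCoeff χ) s := by
  set U : Set ℂ := {s | 1 / 2 < s.re} with hU
  have hUo : IsOpen U := isOpen_re_gt _
  have hUc : IsSimplyConnected U := by
    have : ContractibleSpace U :=
      (convex_halfSpace_re_gt (1 / 2)).contractibleSpace ⟨1, by norm_num⟩
    exact SimplyConnectedSpace.ofContractible U
  have hL := differentiable_LFunction hχ
  obtain ⟨g, hgc, hg⟩ := exists_continuousOn_eqOn_exp_comp hUc hUo hL.continuous.continuousOn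
    (fun ⟨s, hs, h⟩ ↦ hne s hs h)
  have hgd : DifferentiableOn ℂ g U := fun z hz ↦
    (differentiableAt_of_exp_comp (hgc.continuousAt (hUo.mem_nhds hz)) (hL z)
      (by filter_upwards [hUo.mem_nhds hz] with w hw using hg hw)).differentiableWithinAt
  have h2 : (1 : ℝ) < (2 : ℂ).re := by norm_num
  have hexp : ∀ s : ℂ, 1 / 2 < s.re →
      cexp (g s + (LSeries (logCoeff χ) 2 - g 2)) = LFunction χ s := by
    intro s hs
    have e2 : cexp (g 2) = LFunction χ 2 := hg (show (2 : ℂ) ∈ U by simp [U]; norm_num)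
    rw [Complex.exp_add, Complex.exp_sub, e2, exp_LSeries_logCoeff χ h2,
      div_self (hne 2 (by norm_num)), mul_one]
    exact hg hs
  refine ⟨fun s ↦ g s + (LSeries (logCoeff χ) 2 - g 2), hgd.add_const _, hexp, ?_⟩
  have hsub : {s : ℂ | 1 < s.re} ⊆ U := fun s (hs : 1 < s.re) ↦ by
    show 1 / 2 < s.re
    linarith
  refine (isOpen_re_gt 1).eqOn_of_deriv_eq (isPreconnected_re_gt 1) ((hgd.add_const _).mono hsub)
    (fun s hs ↦ (hasDerivAt_LSeries_logCoeff χ hs).differentiableAt.differentiableWithinAt)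
    (fun s hs ↦ ?_) h2 (by simp)
  rw [(hasDerivAt_LSeries_logCoeff χ hs).deriv]
  have hd := ((hgd.add_const (LSeries (logCoeff χ) 2 - g 2)).differentiableAt
    (hUo.mem_nhds (hsub hs))).hasDerivAt.cexp
  have hd2 : HasDerivAt (LFunction χ) _ s := hd.congr_of_eventuallyEq
    (by filter_upwards [hUo.mem_nhds (hsub hs)] with w hw using (hexp w hw).symm)
  rw [hd2.deriv, hexp s (hsub hs), mul_div_cancel_left₀ _ (hne s (hsub hs))]

lemma norm_sum_range_dirichletCharacter_le {q : ℕ} [NeZero q] {χ : DirichletCharacter ℂ q}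
    (hχ : χ ≠ 1) (n : ℕ) : ‖∑ k ∈ range n, χ k‖ ≤ q := by
  have hper : ∑ k ∈ range q, χ k = 0 := by
    obtain ⟨m, rfl⟩ := Nat.exists_eq_succ_of_ne_zero (NeZero.ne q)
    rw [← χ.sum_eq_zero_of_ne_one hχ]
    refine (Fin.sum_univ_eq_sum_range (fun k : ℕ ↦ χ (k : ZMod (m + 1))) (m + 1)).symm.trans ?_
    exact Finset.sum_congr rfl fun i _ ↦ congrArg χ (Fin.cast_val_eq_self i)
  induction n using Nat.strong_induction_on with
  | _ n ih =>
    rcases lt_or_ge n q with h | h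
    · calc ‖∑ k ∈ range n, χ k‖ ≤ ∑ k ∈ range n, (1 : ℝ) :=
            norm_sum_le_of_le _ fun k _ ↦ χ.norm_le_one _
        _ ≤ q := by simpa using h.le
    · obtain ⟨m, rfl⟩ := Nat.exists_eq_add_of_le h
      rw [Finset.sum_range_add, hper, zero_add]
      simpa using ih m (by have := NeZero.pos q; omega)

lemma norm_sum_Icc_dirichletCharacter_le {q : ℕ} [NeZero q] {χ : DirichletCharacter ℂ q}
    (hχ : χ ≠ 1) (n : ℕ) : ‖∑ k ∈ Finset.Icc 1 n, χ k‖ ≤ q := by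
  have hq : q ≠ 1 := fun h ↦ hχ (level_one' χ h)
  have : ∑ k ∈ Finset.Icc 1 n, χ k = ∑ k ∈ range (n + 1), χ k := by
    rw [Finset.range_eq_Ico, Finset.sum_eq_sum_Ico_succ_bot (by omega)]
    simp [χ.map_zero' hq]
    rfl
  rw [this]
  exact norm_sum_range_dirichletCharacter_le hχ _

/-- The Abel summation formula continues `L(s, χ)` to `Re s > 0`. -/
lemma LFunction_eq_mul_mellin {q : ℕ} [NeZero q] {χ : DirichletCharacter ℂ q} (hχ : χ ≠ 1) {s : ℂ}
    (hs : 0 < s.re) :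
    LFunction χ s = s * mellin (fun t : ℝ ↦ ∑ k ∈ Finset.Icc 1 ⌊t⌋₊, χ k) (-s) := by
  set S : ℝ → ℂ := fun t ↦ ∑ k ∈ Finset.Icc 1 ⌊t⌋₊, χ k with hS
  have hS0 {t : ℝ} (ht : t < 1) : S t = 0 := by simp [hS, Nat.floor_eq_zero.2 ht]
  have hSb (t : ℝ) : ‖S t‖ ≤ q := norm_sum_Icc_dirichletCharacter_le hχ _
  have hSm : Measurable S :=
    (measurable_from_nat (f := fun n ↦ ∑ k ∈ Finset.Icc 1 n, χ k)).comp Nat.measurable_floor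
  have hloc : LocallyIntegrableOn S (Ioi 0) := by
    have : LocallyIntegrable S volume := by
      refine (locallyIntegrable_const (q : ℝ)).mono hSm.aestronglyMeasurable ?_
      filter_upwards with t
      simpa using hSb t
    exact this.locallyIntegrableOn _
  have htop : S =O[atTop] fun t : ℝ ↦ t ^ (-(0 : ℝ)) := by
    refine Asymptotics.IsBigO.of_bound q ?_
    filter_upwards with t
    simpa using hSb t
  have hbot (b : ℝ) : S =O[𝓝[>] 0] fun t : ℝ ↦ t ^ (-b) := by
    refine (Asymptotics.isBigO_zero _ _).congr' ?_ EventuallyEq.rfl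
    filter_upwards [nhdsWithin_le_nhds (Iio_mem_nhds (zero_lt_one (α := ℝ)))] with t ht
    exact (hS0 ht).symm
  have hd : DifferentiableOn ℂ (fun s ↦ s * mellin S (-s)) {s | 0 < s.re} := by
    intro z (hz : 0 < z.re)
    have h1 : DifferentiableAt ℂ (mellin S) (-z) :=
      mellin_differentiableAt_of_isBigO_rpow (b := -z.re - 1) hloc htop (by simpa using hz)
        (hbot _) (by simp)
    exact (differentiableAt_id.mul (h1.comp z differentiableAt_id.neg)).differentiableWithinAt
  have heq : ∀ᶠ z in 𝓝 (2 : ℂ), LFunction χ z = z * mellin S (-z) := by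
    filter_upwards [(isOpen_re_gt 1).mem_nhds (show (1 : ℝ) < (2 : ℂ).re by norm_num)] with z hz
    have hz : 1 < z.re := hz
    rw [LFunction_eq_LSeries χ hz, LSeries_eq_mul_integral _ le_rfl (by linarith)
      (LSeriesSummable_of_one_lt_re χ hz)]
    · congr 1
      rw [mellin]
      symm
      rw [setIntegral_eq_of_subset_of_forall_sdiff_eq_zero (s := Ici 1) measurableSet_Ioi
        (Ici_subset_Ioi.2 zero_lt_one) fun t ht ↦ by simp [hS0 (lt_of_not_ge ht.2)],
        integral_Ici_eq_integral_Ioi]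
      refine setIntegral_congr_fun measurableSet_Ioi fun t _ ↦ ?_
      simp only [smul_eq_mul, hS]
      rw [mul_comm]
      congr 2
      ring
    · refine Asymptotics.IsBigO.of_bound q ?_
      filter_upwards with n
      simpa using norm_sum_Icc_dirichletCharacter_le hχ n
  exact ((differentiable_LFunction hχ).differentiableOn.analyticOnNhd
    (isOpen_re_gt 0)).eqOn_of_preconnected_of_eventuallyEq (hd.analyticOnNhd (isOpen_re_gt 0)) (isPreconnected_re_gt 0)
    (show (0 : ℝ) < (2 : ℂ).re by norm_num) heq hs

lemma norm_LFunction_le {q : ℕ} [NeZero q] {χ : DirichletCharacter ℂ q} (hχ : χ ≠ 1) {s : ℂ}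
    (hs : 0 < s.re) : ‖LFunction χ s‖ ≤ q * ‖s‖ / s.re := by
  rw [LFunction_eq_mul_mellin hχ hs, norm_mul, mul_comm (q : ℝ), mul_div_assoc]
  gcongr
  have hint : IntegrableOn (fun t : ℝ ↦ t ^ (-s.re - 1)) (Ioi 1) :=
    integrableOn_Ioi_rpow_of_lt (by linarith) one_pos
  rw [mellin, setIntegral_eq_of_subset_of_forall_sdiff_eq_zero (s := Ici 1) measurableSet_Ioi
        (Ici_subset_Ioi.2 zero_lt_one), integral_Ici_eq_integral_Ioi]
  · calc _ ≤ ∫ t in Ioi (1 : ℝ), t ^ (-s.re - 1) * q := by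
          refine norm_integral_le_of_norm_le (hint.mul_const _) ?_
          refine (ae_restrict_iff' measurableSet_Ioi).2 (.of_forall fun t (ht : 1 < t) ↦ ?_)
          rw [norm_smul, norm_cpow_eq_rpow_re_of_pos (by linarith)]
          have := norm_sum_Icc_dirichletCharacter_le hχ ⌊t⌋₊
          simp only [sub_re, neg_re, one_re]
          gcongr
      _ = q / s.re := by
          rw [integral_mul_const, integral_Ioi_rpow_of_lt (by linarith) one_pos]
          simp [field]
  · intro t ht
    have h : t < 1 := lt_of_not_ge ht.2
    simp [Nat.floor_eq_zero.2 h]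

lemma norm_LSeries_logCoeff_le {q : ℕ} (χ : DirichletCharacter ℂ q) {s : ℂ} (hs : 2 ≤ s.re) :
    ‖LSeries (logCoeff χ) s‖ ≤ ∑' n, ‖LSeries.term (logCoeff χ) 2 n‖ := by
  have h2 : LSeriesSummable (logCoeff χ) 2 :=
    LSeriesSummable_of_abscissaOfAbsConv_lt_re (abscissaOfAbsConv_logCoeff_lt χ (by norm_num))
  have hle (n : ℕ) : ‖LSeries.term (logCoeff χ) s n‖ ≤ ‖LSeries.term (logCoeff χ) 2 n‖ :=
    LSeries.norm_term_le_of_re_le_re _ (by simpa using hs) n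
  exact tsum_of_norm_bounded h2.norm.hasSum hle

/-- Borel–Carathéodory: `log L(s, χ)` grows at most logarithmically to the right of any line
`Re s = 1 - b` with `b < 1/2`. -/
lemma exists_norm_log_LFunction_le {q : ℕ} [NeZero q] {χ : DirichletCharacter ℂ q} (hχ : χ ≠ 1)
    {f : ℂ → ℂ} (hf : DifferentiableOn ℂ f {s | 1 / 2 < s.re})
    (hexp : ∀ s : ℂ, 1 / 2 < s.re → cexp (f s) = LFunction χ s)
    (hser : ∀ s : ℂ, 1 < s.re → f s = LSeries (logCoeff χ) s)
    {b : ℝ} (hb0 : 0 < b) (hb : b < 1 / 2) :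
    ∃ C : ℝ, 0 < C ∧ ∀ (s : ℂ) (t v : ℝ), 4 ≤ t → s.im = t + v → 1 - b ≤ s.re →
      ‖f s‖ ≤ C * Real.log t * (1 + |v|) ^ (1 / 2 : ℝ) := by
  set Z : ℝ := ∑' n, ‖LSeries.term (logCoeff χ) 2 n‖ with hZ
  have hZ0 : 0 ≤ Z := tsum_nonneg fun _ ↦ norm_nonneg _
  have hZle {s : ℂ} (hs : 2 ≤ s.re) : ‖f s‖ ≤ Z := by
    rw [hser s (by linarith)]
    exact norm_LSeries_logCoeff_le χ hs
  have hq : (1 : ℝ) ≤ q := by exact_mod_cast NeZero.one_le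
  have hd : 0 < 1 / 2 - b := by linarith
  have key (s : ℂ) (hs : 1 - b ≤ s.re) :
      ‖f s‖ ≤ 3 / (1 / 2 - b) * (Real.log (2 * q * (|s.im| + 4)) + Z) := by
    have hM : 0 < Real.log (2 * q * (|s.im| + 4)) := by
      apply Real.log_pos
      nlinarith [abs_nonneg s.im]
    rcases le_or_gt 2 s.re with h | h
    · have : 1 ≤ 3 / (1 / 2 - b) := by
        rw [le_div_iff₀ hd]
        linarith
      nlinarith [hZle h]
    · set c : ℂ := ⟨2, s.im⟩ with hc
      have hball {z : ℂ} (hz : z ∈ Metric.ball (0 : ℂ) (3 / 2)) : 1 / 2 < (c + z).re := by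
        have h1 : ‖z‖ < 3 / 2 := by simpa using hz
        have := (abs_le.1 (abs_re_le_norm z)).1
        simp only [add_re, hc]
        linarith
      have hg : DifferentiableOn ℂ (fun z ↦ f (c + z)) (Metric.ball 0 (3 / 2)) :=
        hf.comp (by fun_prop) fun z hz ↦ hball hz
      have hmaps : MapsTo (fun z ↦ f (c + z)) (Metric.ball 0 (3 / 2))
          {z | z.re ≤ Real.log (2 * q * (|s.im| + 4))} := by
        intro z hz
        show (f (c + z)).re ≤ _
        have h1 := hball hz
        have hn : ‖c + z‖ ≤ |s.im| + 4 := by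
          have h3 : ‖z‖ < 3 / 2 := by simpa using hz
          have h4 : ‖c‖ ≤ |c.re| + |c.im| := norm_le_abs_re_add_abs_im c
          simp only [hc, Nat.abs_ofNat] at h4
          linarith [norm_add_le c z]
        rw [Real.le_log_iff_exp_le (by positivity), ← Complex.norm_exp, hexp _ h1]
        refine (norm_LFunction_le hχ (by linarith)).trans ?_
        rw [div_le_iff₀ (by linarith)]
        nlinarith [norm_nonneg (c + z), mul_nonneg (zero_le_one.trans hq) (norm_nonneg (c + z)),
          mul_le_mul_of_nonneg_left hn (zero_le_one.trans hq)]
      have hz : ‖s - c‖ = 2 - s.re := by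
        have : s - c = ((s.re - 2 : ℝ) : ℂ) := by
          apply Complex.ext <;> simp [hc]
        rw [this, norm_real, Real.norm_eq_abs, abs_of_neg (by linarith)]
        ring
      have hbc := borelCaratheodory hM hg hmaps (by norm_num) (z := s - c)
        (by simp only [Metric.mem_ball, dist_zero_right, hz]; linarith)
      simp only [add_sub_cancel, add_zero, hz] at hbc
      have hfc : ‖f c‖ ≤ Z := hZle le_rfl
      refine hbc.trans ?_
      rw [← add_div, div_mul_eq_mul_div]
      refine div_le_div₀ (by positivity) ?_ hd (by linarith)
      have h6 : ‖f c‖ * (3 / 2 + (2 - s.re)) ≤ Z * 3 :=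
        mul_le_mul hfc (by linarith) (by linarith) hZ0
      nlinarith
  refine ⟨3 / (1 / 2 - b) * (Real.log (4 * q) + 3 + Z), ?_, ?_⟩
  · have : 0 ≤ Real.log (4 * q) := Real.log_nonneg (by linarith)
    positivity
  intro s t v ht hst hs
  have hlogt : 1 ≤ Real.log t := by
    rw [Real.le_log_iff_exp_le (by linarith)]
    linarith [Real.exp_one_lt_d9]
  have hv : 1 ≤ (1 + |v|) ^ (1 / 2 : ℝ) := Real.one_le_rpow (by linarith [abs_nonneg v]) (by norm_num)
  have hlogq : 0 ≤ Real.log (4 * q) := Real.log_nonneg (by linarith)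
  have h1 : Real.log (2 * q * (|s.im| + 4)) ≤
      Real.log (4 * q) + Real.log t + 2 * (1 + |v|) ^ (1 / 2 : ℝ) := by
    have h2 : Real.log (1 + |v|) ≤ (1 + |v|) ^ (1 / 2 : ℝ) / (1 / 2) :=
      Real.log_le_rpow_div (by positivity) (by norm_num)
    have h3 : 2 * q * (|s.im| + 4) ≤ 4 * q * t * (1 + |v|) := by
      have : |s.im| ≤ t + |v| := by
        rw [hst]
        have h4 := abs_add_le t v
        rwa [abs_of_nonneg (by linarith : (0 : ℝ) ≤ t)] at h4
      have h5 : |s.im| + 4 ≤ 2 * (t * (1 + |v|)) := by nlinarith [abs_nonneg v]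
      nlinarith
    calc Real.log (2 * q * (|s.im| + 4)) ≤ Real.log (4 * q * t * (1 + |v|)) :=
          Real.log_le_log (by positivity) h3
      _ = Real.log (4 * q) + Real.log t + Real.log (1 + |v|) := by
          rw [Real.log_mul (by positivity) (by positivity),
            Real.log_mul (by positivity) (by positivity)]
      _ ≤ _ := by linarith
  refine (key s hs).trans ?_
  set V := (1 + |v|) ^ (1 / 2 : ℝ)
  set T := Real.log t
  suffices h : Real.log (2 * q * (|s.im| + 4)) + Z ≤ (Real.log (4 * q) + 3 + Z) * (T * V) by
    calc _ ≤ 3 / (1 / 2 - b) * ((Real.log (4 * q) + 3 + Z) * (T * V)) :=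
          mul_le_mul_of_nonneg_left h (by positivity)
      _ = _ := by ring
  have hTV : 1 ≤ T * V := by nlinarith
  have e1 : Real.log (4 * q) ≤ Real.log (4 * q) * (T * V) := le_mul_of_one_le_right hlogq hTV
  have e2 : Z ≤ Z * (T * V) := le_mul_of_one_le_right hZ0 hTV
  have e3 : T ≤ T * V := le_mul_of_one_le_right (by linarith) hv
  have e4 : V ≤ T * V := le_mul_of_one_le_left (by linarith) hlogt
  linarith

lemma integrable_one_add_abs_rpow {r : ℝ} (hr : 1 < r) :
    Integrable fun v : ℝ ↦ (1 + |v|) ^ (-r) :=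
  integrable_one_add_norm (E := ℝ) (by simpa using hr)

/-- Cauchy's theorem in a vertical strip. -/
lemma integral_vertical_eq_of_norm_le {G : ℂ → ℂ} {a c B r : ℝ} (hac : a ≤ c) (hr : 1 < r)
    (hG : DifferentiableOn ℂ G {w | a ≤ w.re})
    (hB : ∀ u v : ℝ, u ∈ Set.Icc a c → 1 ≤ |v| → ‖G (u + v * I)‖ ≤ B * (1 + |v|) ^ (-r))
    (ha : Integrable fun v : ℝ ↦ G (a + v * I)) (hc : Integrable fun v : ℝ ↦ G (c + v * I)) :
    ∫ v : ℝ, G (a + v * I) = ∫ v : ℝ, G (c + v * I) := by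
  have rect (T : ℝ) : (∫ u in a..c, G (u + (-T : ℝ) * I)) - (∫ u in a..c, G (u + T * I)) +
      I * (∫ v in -T..T, G (c + v * I)) - I * (∫ v in -T..T, G (a + v * I)) = 0 := by
    have h := integral_boundary_rect_eq_zero_of_differentiableOn G ⟨a, -T⟩ ⟨c, T⟩ (hG.mono ?_)
    · simpa using h
    · intro w hw
      have := hw.1
      simp only [Set.mem_preimage, uIcc_of_le hac] at this
      exact this.1
  have hor (e : ℝ) (he : |e| = 1) :
      Tendsto (fun T : ℝ ↦ ∫ u in a..c, G (u + (e * T : ℝ) * I)) atTop (𝓝 0) := by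
    have h0 : Tendsto (fun T : ℝ ↦ B * (1 + T) ^ (-r) * |c - a|) atTop (𝓝 0) := by
      have h1 : Tendsto (fun T : ℝ ↦ (1 + T) ^ (-r)) atTop (𝓝 0) :=
        (tendsto_rpow_neg_atTop (by linarith)).comp (tendsto_atTop_add_const_left _ _ tendsto_id)
      simpa using (h1.const_mul B).mul_const |c - a|
    refine squeeze_zero_norm' ?_ h0
    filter_upwards [eventually_ge_atTop 1] with T hT
    refine intervalIntegral.norm_integral_le_of_norm_le_const fun u hu ↦ ?_
    rw [uIoc_of_le hac] at hu
    have h2 : |e * T| = T := by rw [abs_mul, he, one_mul, abs_of_nonneg (by linarith)]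
    have := hB u (e * T) ⟨hu.1.le, hu.2⟩ (by rw [h2]; exact hT)
    rwa [h2] at this
  have lim {g : ℝ → ℂ} (hg : Integrable g) :
      Tendsto (fun T : ℝ ↦ ∫ v in -T..T, g v) atTop (𝓝 (∫ v, g v)) :=
    intervalIntegral_tendsto_integral hg tendsto_neg_atTop_atBot tendsto_id
  have h := (((hor (-1) (by simp)).sub (hor 1 (by simp))).add ((lim hc).const_mul I)).sub
    ((lim ha).const_mul I)
  have h' := tendsto_nhds_unique (h.congr fun T ↦ by simpa using rect T) tendsto_const_nhds
  have : I * (∫ v : ℝ, G (c + v * I)) - I * ∫ v : ℝ, G (a + v * I) = 0 := by simpa using h'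
  rw [← mul_sub, mul_eq_zero, or_iff_right I_ne_zero] at this
  exact (sub_eq_zero.1 this).symm

lemma one_add_abs_le_mul_norm {w : ℂ} {d : ℝ} (hd : 0 < d) (hw : d ≤ ‖w‖) :
    1 + |w.im| ≤ (1 + 1 / d) * ‖w‖ := by
  have h1 : 1 ≤ 1 / d * ‖w‖ := by rwa [one_div_mul_eq_div, one_le_div hd]
  linarith [abs_im_le_norm w]

lemma norm_inv_mul_add_one_le {w : ℂ} {d e : ℝ} (hd : 0 < d) (hw : d ≤ ‖w‖) (he : 0 < e)
    (hw' : e ≤ ‖w + 1‖) :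
    ‖1 / (w * (w + 1))‖ ≤ (1 + 1 / d) * (1 + 1 / e) * (1 + |w.im|) ^ (-2 : ℝ) := by
  have h1 := one_add_abs_le_mul_norm hd hw
  have h2 := one_add_abs_le_mul_norm he hw'
  simp only [add_im, one_im, add_zero] at h2
  have h0 : 0 < 1 + |w.im| := by positivity
  rw [Real.rpow_neg h0.le, Real.rpow_two, norm_div, norm_mul, norm_one, ← div_eq_mul_inv,
    div_le_div_iff₀ (mul_pos (hd.trans_le hw) (he.trans_le hw')) (by positivity), one_mul, sq]
  calc _ ≤ ((1 + 1 / d) * ‖w‖) * ((1 + 1 / e) * ‖w + 1‖) :=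
        mul_le_mul h1 h2 h0.le (by positivity)
    _ = _ := by ring

lemma integrable_inv_mul_add_one :
    Integrable fun v : ℝ ↦ 1 / (((1 : ℝ) + v * I : ℂ) * ((1 : ℝ) + v * I + 1)) := by
  have hre (v : ℝ) : ((1 : ℝ) + v * I : ℂ).re = 1 := by simp
  have hn (v : ℝ) : 1 ≤ ‖((1 : ℝ) + v * I : ℂ)‖ := by
    simpa using abs_re_le_norm ((1 : ℝ) + v * I : ℂ)
  have hn' (v : ℝ) : 1 ≤ ‖((1 : ℝ) + v * I + 1 : ℂ)‖ := by
    have := abs_re_le_norm ((1 : ℝ) + v * I + 1 : ℂ)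
    norm_num at this ⊢
    linarith
  refine ((integrable_one_add_abs_rpow one_lt_two).const_mul
    ((1 + 1 / 1) * (1 + 1 / 1))).mono' ?_ (Eventually.of_forall fun v ↦ ?_)
  · refine Continuous.aestronglyMeasurable (Continuous.div₀ (by fun_prop) (by fun_prop) fun v ↦ ?_)
    exact mul_ne_zero (norm_pos_iff.1 (by linarith [hn v])) (norm_pos_iff.1 (by linarith [hn' v]))
  · simpa using norm_inv_mul_add_one_le one_pos (hn v) one_pos (hn' v)

/-- Perron's formula with the weight `max (1 - y) 0`. -/
lemma integral_cpow_div_mul_add_one {y : ℝ} (hy : 0 < y) :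
    ∫ v : ℝ, (y : ℂ) ^ (-((1 : ℝ) + v * I : ℂ)) *
      (1 / (((1 : ℝ) + v * I : ℂ) * ((1 : ℝ) + v * I + 1))) =
      2 * Real.pi * (max (1 - y) 0 : ℝ) := by
  set k : ℝ → ℂ := fun y ↦ (max (1 - y) 0 : ℝ) with hk
  have hm {s : ℂ} (hs : 0 < s.re) : HasMellin k s (1 / (s * (s + 1))) := by
    have h1 := (hasMellin_one_Ioc hs)
    have h2 := (hasMellin_cpow_Ioc 1 (s := s) (by simp; linarith))
    have h3 := hasMellin_sub h1.1 h2.1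
    rw [h1.2, h2.2] at h3
    have e : 1 / s - 1 / (s + 1) = 1 / (s * (s + 1)) := by
      have a1 : s ≠ 0 := by rintro rfl; simp at hs
      have a2 : s + 1 ≠ 0 := by
        intro h
        have := congrArg re h
        simp at this
        linarith
      field_simp
      ring
    rw [e] at h3
    have hcongr : ∀ t ∈ Set.Ioi (0 : ℝ), (t : ℂ) ^ (s - 1) • (Set.indicator (Set.Ioc 0 1) (fun _ ↦ (1 : ℂ)) t -
        Set.indicator (Set.Ioc 0 1) (fun t : ℝ ↦ (t : ℂ) ^ (1 : ℂ)) t) = (t : ℂ) ^ (s - 1) • k t := by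
      intro t ht
      congr 1
      simp only [hk]
      rcases le_or_gt t 1 with h | h
      · have hmem : t ∈ Set.Ioc (0 : ℝ) 1 := ⟨ht, h⟩
        rw [Set.indicator_of_mem hmem, Set.indicator_of_mem hmem, max_eq_left (by linarith)]
        simp
      · rw [Set.indicator_of_notMem (by simp [h]), Set.indicator_of_notMem (by simp [h]),
          max_eq_right (by linarith)]
        simp
    exact ⟨h3.1.congr_fun hcongr measurableSet_Ioi,
      (setIntegral_congr_fun measurableSet_Ioi hcongr).symm.trans h3.2⟩
  have hline (v : ℝ) : mellin k ((1 : ℝ) + v * I) =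
      1 / (((1 : ℝ) + v * I : ℂ) * ((1 : ℝ) + v * I + 1)) := (hm (by simp)).2
  have h := mellinInv_mellin_eq 1 k hy (by simpa using (hm (s := 1) (by simp)).1)
    (by simpa only [VerticalIntegrable, hline] using integrable_inv_mul_add_one)
    (by fun_prop)
  rw [mellinInv] at h
  simp only [hline, smul_eq_mul] at h
  rw [hk] at h
  simp only at h
  rw [← h, real_smul, ← mul_assoc]
  push_cast
  rw [mul_one_div_cancel (by simp), one_mul]

lemma inv_cpow_neg_ofReal {x : ℝ} (hx : 0 < x) (w : ℂ) :
    ((x⁻¹ : ℝ) : ℂ) ^ (-w) = (x : ℂ) ^ w := by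
  rw [ofReal_inv, inv_cpow _ _ (by rw [arg_ofReal_of_nonneg hx.le]; exact Real.pi_pos.ne),
    cpow_neg, inv_inv]

/-- Perron's formula for a Dirichlet series, smoothed with the weight `max (1 - n / x) 0`. -/
lemma integral_LSeries_mul_cpow {a : ℕ → ℂ} {s : ℂ} (ha : LSeriesSummable a (s + 1)) {x : ℝ}
    (hx : 0 < x) :
    (Integrable fun v : ℝ ↦ LSeries a (s + ((1 : ℝ) + v * I)) * ((x : ℂ) ^ ((1 : ℝ) + v * I : ℂ) *
      (1 / (((1 : ℝ) + v * I : ℂ) * ((1 : ℝ) + v * I + 1))))) ∧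
    ∫ v : ℝ, LSeries a (s + ((1 : ℝ) + v * I)) * ((x : ℂ) ^ ((1 : ℝ) + v * I : ℂ) *
      (1 / (((1 : ℝ) + v * I : ℂ) * ((1 : ℝ) + v * I + 1)))) =
      2 * Real.pi * ∑ n ∈ Finset.Icc 1 ⌊x⌋₊, LSeries.term a s n * (max (1 - n / x) 0 : ℝ) := by
  set k : ℝ → ℂ := fun v ↦ 1 / (((1 : ℝ) + v * I : ℂ) * ((1 : ℝ) + v * I + 1)) with hk
  have hki : Integrable k := integrable_inv_mul_add_one
  have hre (v : ℝ) : ((1 : ℝ) + v * I : ℂ).re = 1 := by simp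
  set F : ℕ → ℝ → ℂ := fun n v ↦ LSeries.term a (s + ((1 : ℝ) + v * I)) n *
    ((x : ℂ) ^ ((1 : ℝ) + v * I : ℂ) * k v) with hF
  have hcont (n : ℕ) : Continuous fun v : ℝ ↦
      LSeries.term a (s + ((1 : ℝ) + v * I)) n * (x : ℂ) ^ ((1 : ℝ) + v * I : ℂ) := by
    have hxc : (x : ℂ) ≠ 0 := by exact_mod_cast hx.ne'
    have h2 : Continuous fun v : ℝ ↦ (x : ℂ) ^ ((1 : ℝ) + v * I : ℂ) :=
      Continuous.const_cpow (by fun_prop) (Or.inl hxc)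
    rcases eq_or_ne n 0 with rfl | hn
    · simp only [LSeries.term_zero, zero_mul]
      exact continuous_const
    · simp only [LSeries.term_of_ne_zero hn]
      refine Continuous.mul (Continuous.div₀ continuous_const
        (Continuous.const_cpow (by fun_prop) (Or.inl (by exact_mod_cast hn))) fun v ↦ ?_) h2
      simp [cpow_eq_zero_iff, hn]
  have hnorm (n : ℕ) (v : ℝ) : ‖F n v‖ = ‖LSeries.term a (s + 1) n‖ * (x * ‖k v‖) := by
    rw [hF, norm_mul, norm_mul, norm_cpow_eq_rpow_re_of_pos hx, hre, Real.rpow_one,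
      LSeries.norm_term_eq, LSeries.norm_term_eq, add_re, hre, add_re, one_re]
  have hint (n : ℕ) : Integrable (F n) := by
    refine ((hki.norm.const_mul x).const_mul ‖LSeries.term a (s + 1) n‖).mono' ?_
      (Eventually.of_forall fun v ↦ (hnorm n v).le)
    have := (hcont n).aestronglyMeasurable.mul hki.1
    refine this.congr (Eventually.of_forall fun v ↦ ?_)
    simp only [hF, Pi.mul_apply, mul_assoc]
  have hsum : Summable fun n ↦ ∫ v, ‖F n v‖ := by
    simp only [hnorm, integral_const_mul]
    exact ha.norm.mul_right _
  have hFtsum (v : ℝ) : ∑' n, F n v = LSeries a (s + ((1 : ℝ) + v * I)) *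
      ((x : ℂ) ^ ((1 : ℝ) + v * I : ℂ) * k v) := by
    simp only [hF, tsum_mul_right, LSeries]
  have hval (n : ℕ) : ∫ v, F n v =
      2 * Real.pi * (LSeries.term a s n * (max (1 - n / x) 0 : ℝ)) := by
    rcases eq_or_ne n 0 with rfl | hn
    · simp [hF]
    · have hn0 : (0 : ℝ) < n := by exact_mod_cast hn.bot_lt
      have e (v : ℝ) : F n v = LSeries.term a s n *
          (((n / x : ℝ) : ℂ) ^ (-((1 : ℝ) + v * I : ℂ)) * k v) := by
        simp only [hF]
        rw [LSeries.term_of_ne_zero hn, LSeries.term_of_ne_zero hn,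
          cpow_add _ _ (by exact_mod_cast hn), div_eq_mul_inv (n : ℝ), ofReal_mul,
          mul_cpow_ofReal_nonneg hn0.le (by positivity), inv_cpow_neg_ofReal hx, cpow_neg,
          ofReal_natCast, div_mul_eq_div_div]
        ring
      simp only [e, integral_const_mul, hk]
      rw [integral_cpow_div_mul_add_one (by positivity)]
      ring
  have htot := hasSum_integral_of_summable_integral_norm hint hsum
  simp only [hFtsum, hval] at htot
  constructor
  · have hS : Integrable fun v ↦ (∑' n, ‖LSeries.term a (s + 1) n‖) * (x * ‖k v‖) :=
      (hki.norm.const_mul x).const_mul _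
    refine hS.mono' ?_ (Eventually.of_forall fun v ↦ ?_)
    · have hsm (v : ℝ) : Summable fun n ↦ F n v :=
        Summable.of_norm (by simpa only [hnorm] using ha.norm.mul_right _)
      refine aestronglyMeasurable_of_tendsto_ae atTop
        (f := fun N v ↦ ∑ n ∈ Finset.range N, F n v) (fun N ↦ ?_) (Eventually.of_forall fun v ↦ ?_)
      · exact (integrable_finsetSum _ fun n _ ↦ hint n).1
      · rw [← hFtsum]
        exact (hsm v).hasSum.tendsto_sum_nat
    · rw [← hFtsum]
      refine tsum_of_norm_bounded (ha.norm.hasSum.mul_right _) fun n ↦ (hnorm n v).le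
  · rw [← htot.tsum_eq, tsum_eq_sum (s := Finset.Icc 1 ⌊x⌋₊), Finset.mul_sum]
    intro n hn
    rcases eq_or_ne n 0 with rfl | hn0
    · simp
    · have : x < n := by
        by_contra! h
        exact hn (Finset.mem_Icc.2 ⟨Nat.one_le_iff_ne_zero.2 hn0, Nat.le_floor h⟩)
      rw [max_eq_right (by rw [sub_nonpos, one_le_div hx]; exact this.le)]
      simp

lemma norm_log_LFunction_le_sum {q : ℕ} [NeZero q] {χ : DirichletCharacter ℂ q} (hχ : χ ≠ 1)
    {f : ℂ → ℂ} (hf : DifferentiableOn ℂ f {s | 1 / 2 < s.re})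
    (hexp : ∀ s : ℂ, 1 / 2 < s.re → cexp (f s) = LFunction χ s)
    (hser : ∀ s : ℂ, 1 < s.re → f s = LSeries (logCoeff χ) s)
    {b : ℝ} (hb0 : 0 < b) (hb : b < 1 / 2) :
    ∃ C : ℝ, 0 < C ∧ ∀ (s : ℂ) (x : ℝ), 4 ≤ s.im → 1 ≤ s.re → 1 ≤ x →
      ‖f s‖ ≤ ∑ n ∈ Finset.Icc 1 ⌊x⌋₊, ‖logCoeff χ n‖ / n + C * Real.log s.im * x ^ (-b) := by
  obtain ⟨C, hC0, hC⟩ := exists_norm_log_LFunction_le hχ hf hexp hser hb0 hb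
  set J : ℝ := ∫ v : ℝ, (1 + |v|) ^ (-(3 / 2) : ℝ) with hJ
  have hJ0 : 0 ≤ J := integral_nonneg fun v ↦ by positivity
  refine ⟨6 * C * (1 + 1 / b) * J + C, by positivity, fun s x hs4 hs1 hx ↦ ?_⟩
  have hx0 : 0 < x := by linarith
  set T := Real.log s.im with hT
  have hT0 : 0 ≤ T := Real.log_nonneg (by linarith)
  set F : ℂ → ℂ := fun w ↦ f (s + w) with hF
  have hFd : DifferentiableOn ℂ F {w | -(1 / 2) < w.re} :=
    hf.comp (by fun_prop) fun w hw ↦ by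
      simp only [Set.mem_ofPred_eq, add_re] at hw ⊢
      linarith
  have hF0 : ‖F 0‖ ≤ C * T := by
    simpa [hF] using hC s s.im 0 hs4 (by simp) (by linarith)
  set G : ℂ → ℂ := fun w ↦ dslope F 0 w * ((x : ℂ) ^ w / (w + 1)) with hG
  have hGd : DifferentiableOn ℂ G {w | -(1 / 2) < w.re} := by
    have h1 : DifferentiableOn ℂ (dslope F 0) {w | -(1 / 2) < w.re} :=
      (Complex.differentiableOn_dslope ((isOpen_re_gt _).mem_nhds (by simp))).2 hFd
    refine h1.mul fun w hw ↦ DifferentiableAt.differentiableWithinAt ?_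
    have hxc : (x : ℂ) ≠ 0 := by exact_mod_cast hx0.ne'
    refine DifferentiableAt.div (by fun_prop (disch := simp [hxc])) (by fun_prop) ?_
    intro h
    have := congrArg re h
    simp only [Set.mem_ofPred_eq, add_re, one_re, zero_re] at hw this
    linarith
  have hGeq {w : ℂ} (hw : w ≠ 0) :
      G w = (F w - F 0) * ((x : ℂ) ^ w * (1 / (w * (w + 1)))) := by
    simp only [hG, dslope_of_ne _ hw, slope_def_field]
    rw [sub_zero, one_div, mul_inv]
    ring
  have hGb (d : ℝ) (hd : 0 < d) (w : ℂ) (hwd : d ≤ ‖w‖) (hw : -b ≤ w.re) :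
      ‖G w‖ ≤ 6 * C * (1 + 1 / d) * T * x ^ w.re * (1 + |w.im|) ^ (-(3 / 2) : ℝ) := by
    have hV : 1 ≤ (1 + |w.im|) ^ (1 / 2 : ℝ) :=
      Real.one_le_rpow (by linarith [abs_nonneg w.im]) (by norm_num)
    have h1 : ‖F w - F 0‖ ≤ 2 * C * T * (1 + |w.im|) ^ (1 / 2 : ℝ) := by
      have h2 := hC (s + w) s.im w.im hs4 (by simp) (by simp; linarith)
      have h3 : C * T ≤ C * T * (1 + |w.im|) ^ (1 / 2 : ℝ) :=
        le_mul_of_one_le_right (by positivity) hV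
      linarith [norm_sub_le (F w) (F 0)]
    have h2 := norm_inv_mul_add_one_le hd hwd (e := 1 / 2) (by norm_num) (by
      have := abs_re_le_norm (w + 1)
      rw [add_re, one_re, abs_of_nonneg (by linarith)] at this
      linarith)
    have hw0 : w ≠ 0 := norm_pos_iff.1 (hd.trans_le hwd)
    rw [hGeq hw0, norm_mul, norm_mul, norm_cpow_eq_rpow_re_of_pos hx0]
    calc _ ≤ (2 * C * T * (1 + |w.im|) ^ (1 / 2 : ℝ)) * (x ^ w.re *
          ((1 + 1 / d) * (1 + 1 / (1 / 2)) * (1 + |w.im|) ^ (-2 : ℝ))) := by gcongr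
      _ = 6 * C * (1 + 1 / d) * T * x ^ w.re *
          ((1 + |w.im|) ^ (1 / 2 : ℝ) * (1 + |w.im|) ^ (-2 : ℝ)) := by ring
      _ = _ := by
        rw [← Real.rpow_add (by positivity)]
        norm_num
  have hline (u : ℝ) (hu : u ≠ 0) (hu' : -b ≤ u) (v : ℝ) : ‖G (u + v * I)‖ ≤
      6 * C * (1 + 1 / |u|) * T * x ^ u * (1 + |v|) ^ (-(3 / 2) : ℝ) := by
    have := hGb |u| (abs_pos.2 hu) (u + v * I) (by simpa using abs_re_le_norm (u + v * I : ℂ))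
      (by simpa using hu')
    simpa using this
  have hJi : Integrable fun v : ℝ ↦ (1 + |v|) ^ (-(3 / 2) : ℝ) :=
    integrable_one_add_abs_rpow (by norm_num)
  have hcont (u : ℝ) (hu : -b ≤ u) : Continuous fun v : ℝ ↦ G (u + v * I) := by
    refine hGd.continuousOn.comp_continuous (by fun_prop) fun v ↦ ?_
    simp only [Set.mem_ofPred_eq, add_re, ofReal_re, re_ofReal_mul, I_re, mul_zero, add_zero]
    linarith
  have hlinei (u : ℝ) (hu : u ≠ 0) (hu' : -b ≤ u) : Integrable fun v : ℝ ↦ G (u + v * I) :=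
    (hJi.const_mul _).mono' (hcont u hu').aestronglyMeasurable
      (Eventually.of_forall (hline u hu hu'))
  have hshift := integral_vertical_eq_of_norm_le (a := -b) (c := 1) (r := 3 / 2)
    (B := 6 * C * (1 + 1 / 1) * T * x) (by linarith) (by norm_num)
    (hGd.mono fun w hw ↦ by simp only [Set.mem_ofPred_eq] at hw ⊢; linarith)
    (fun u v hu hv ↦ by
      have := hGb 1 one_pos (u + v * I)
        (hv.trans (by simpa using abs_im_le_norm (u + v * I : ℂ))) (by simpa using hu.1)
      simp only [add_re, ofReal_re, re_ofReal_mul, I_re, mul_zero, add_zero, add_im, ofReal_im,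
        im_ofReal_mul, I_im, mul_one, zero_add] at this
      refine this.trans ?_
      gcongr
      simpa using Real.rpow_le_rpow_of_exponent_le hx hu.2)
    (hlinei _ (by linarith) le_rfl) (hlinei _ one_ne_zero (by linarith))
  obtain ⟨hLi, hL⟩ := integral_LSeries_mul_cpow (a := logCoeff χ) (s := s)
    (LSeriesSummable_of_abscissaOfAbsConv_lt_re
      (abscissaOfAbsConv_logCoeff_lt χ (by simp; linarith))) hx0
  have hright : ∫ v : ℝ, G ((1 : ℝ) + v * I) = 2 * Real.pi *
      (∑ n ∈ Finset.Icc 1 ⌊x⌋₊, LSeries.term (logCoeff χ) s n * (max (1 - n / x) 0 : ℝ)) -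
      F 0 * (2 * Real.pi * (1 - x⁻¹ : ℝ)) := by
    have hne (v : ℝ) : ((1 : ℝ) + v * I : ℂ) ≠ 0 := fun h ↦ by simpa using congrArg re h
    have e (v : ℝ) : G ((1 : ℝ) + v * I) = LSeries (logCoeff χ) (s + ((1 : ℝ) + v * I)) *
        ((x : ℂ) ^ ((1 : ℝ) + v * I : ℂ) * (1 / (((1 : ℝ) + v * I : ℂ) * ((1 : ℝ) + v * I + 1)))) -
        F 0 * (((x⁻¹ : ℝ) : ℂ) ^ (-((1 : ℝ) + v * I : ℂ)) *
          (1 / (((1 : ℝ) + v * I : ℂ) * ((1 : ℝ) + v * I + 1)))) := by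
      rw [hGeq (hne v), inv_cpow_neg_ofReal hx0, sub_mul, ← hser _ (by simp; linarith)]
    have hi2 : Integrable fun v : ℝ ↦ ((x⁻¹ : ℝ) : ℂ) ^ (-((1 : ℝ) + v * I : ℂ)) *
          (1 / (((1 : ℝ) + v * I : ℂ) * ((1 : ℝ) + v * I + 1))) := by
      refine (integrable_inv_mul_add_one.norm.const_mul x).mono' ?_
        (Eventually.of_forall fun v ↦ ?_)
      · simp only [inv_cpow_neg_ofReal hx0]
        refine Continuous.aestronglyMeasurable ?_ |>.mul integrable_inv_mul_add_one.1
        exact Continuous.const_cpow (by fun_prop) (Or.inl (by exact_mod_cast hx0.ne'))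
      · rw [inv_cpow_neg_ofReal hx0, norm_mul, norm_cpow_eq_rpow_re_of_pos hx0]
        simp
    simp only [e]
    rw [integral_sub hLi (hi2.const_mul _), hL, integral_const_mul,
      integral_cpow_div_mul_add_one (by positivity),
      max_eq_left (by rw [sub_nonneg]; exact inv_le_one_of_one_le₀ hx)]
  have hleft : ‖∫ v : ℝ, G ((-b : ℝ) + v * I)‖ ≤
      6 * C * (1 + 1 / b) * T * x ^ (-b) * J := by
    rw [hJ, ← integral_const_mul]
    refine norm_integral_le_of_norm_le (hJi.const_mul _) (Eventually.of_forall fun v ↦ ?_)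
    simpa [abs_of_pos hb0] using hline (-b) (by linarith) le_rfl v
  have hA : ‖∑ n ∈ Finset.Icc 1 ⌊x⌋₊, LSeries.term (logCoeff χ) s n * (max (1 - n / x) 0 : ℝ)‖ ≤
      ∑ n ∈ Finset.Icc 1 ⌊x⌋₊, ‖logCoeff χ n‖ / n := by
    refine norm_sum_le_of_le _ fun n hn ↦ ?_
    have hn1 := (Finset.mem_Icc.1 hn).1
    have hn1' : (1 : ℝ) ≤ n := by exact_mod_cast hn1
    rw [norm_mul, norm_real, Real.norm_of_nonneg (le_max_right _ _), LSeries.norm_term_eq,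
      if_neg (by omega)]
    calc _ ≤ ‖logCoeff χ n‖ / (n : ℝ) ^ s.re * 1 := by
          gcongr
          exact max_le (by linarith [show (0 : ℝ) ≤ n / x by positivity]) zero_le_one
      _ ≤ _ := by
          rw [mul_one]
          gcongr
          simpa using Real.rpow_le_rpow_of_exponent_le hn1' hs1
  set A := ∑ n ∈ Finset.Icc 1 ⌊x⌋₊, LSeries.term (logCoeff χ) s n * (max (1 - n / x) 0 : ℝ)
  set E := ∫ v : ℝ, G ((-b : ℝ) + v * I)
  have hpi : (Real.pi : ℂ) ≠ 0 := by exact_mod_cast Real.pi_ne_zero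
  have hfin : f s = A + F 0 * (x⁻¹ : ℝ) - (2 * Real.pi : ℂ)⁻¹ * E := by
    have : F 0 = f s := by simp [hF]
    rw [← this]
    have h3 : E = 2 * Real.pi * A - F 0 * (2 * Real.pi * (1 - x⁻¹ : ℝ)) := hshift.trans hright
    rw [h3]
    push_cast
    field_simp
    ring
  have hxinv : x⁻¹ ≤ x ^ (-b) := by
    rw [← Real.rpow_neg_one]
    exact Real.rpow_le_rpow_of_exponent_le hx (by linarith)
  have hpiinv : ‖((2 * Real.pi)⁻¹ : ℂ)‖ ≤ 1 := by
    rw [norm_inv, norm_mul, norm_real, Real.norm_of_nonneg Real.pi_pos.le]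
    refine inv_le_one_of_one_le₀ ?_
    norm_num
    linarith [Real.pi_gt_three]
  calc ‖f s‖ ≤ ‖A‖ + ‖F 0‖ * x⁻¹ + ‖((2 * Real.pi)⁻¹ : ℂ)‖ * ‖E‖ := by
        rw [hfin]
        refine (norm_sub_le _ _).trans (add_le_add ((norm_add_le _ _).trans ?_) (norm_mul _ _).le)
        rw [norm_mul, norm_real, Real.norm_of_nonneg (by positivity)]
    _ ≤ ∑ n ∈ Finset.Icc 1 ⌊x⌋₊, ‖logCoeff χ n‖ / n + C * T * x ^ (-b) +
        1 * (6 * C * (1 + 1 / b) * T * x ^ (-b) * J) := by gcongr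
    _ = _ := by ring

/-- **Mertens' first theorem**. -/
lemma abs_sum_vonMangoldt_div_sub_log_le {N : ℕ} (hN : N ≠ 0) :
    |∑ n ∈ Finset.Ioc 0 N, Λ n / n - Real.log N| ≤ Real.log 4 + 5 := by
  have hN0 : (0 : ℝ) < N := by exact_mod_cast hN.bot_lt
  have hfac : ∑ n ∈ Finset.Ioc 0 N, Λ n * (N / n : ℕ) = Real.log (N.factorial) := by
    have h1 := ArithmeticFunction.sum_Ioc_mul_zeta_eq_sum (Λ) N
    rw [vonMangoldt_mul_zeta] at h1
    rw [← h1]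
    clear h1 hN0 hN
    induction N with
    | zero => simp
    | succ n ih =>
      rw [← Finset.insert_Ioc_right_eq_Ioc_add_one (Nat.zero_le n), Finset.sum_insert (by simp), ih,
        Nat.factorial_succ, Nat.cast_mul, Real.log_mul (by positivity) (by positivity), log_apply]
  have hlow : N * Real.log N - N ≤ Real.log (N.factorial) := by
    have h1 := Stirling.le_log_factorial_stirling hN
    have h2 : 0 ≤ Real.log N := Real.log_natCast_nonneg N
    have h3 : 0 ≤ Real.log (2 * Real.pi) := Real.log_nonneg (by linarith [Real.pi_gt_three])
    linarith
  have hup : Real.log (N.factorial) ≤ N * Real.log N := by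
    rw [← Real.log_pow]
    exact Real.log_le_log (by positivity) (by exact_mod_cast Nat.factorial_le_pow N)
  have hpsi : ∑ n ∈ Finset.Ioc 0 N, Λ n ≤ (Real.log 4 + 4) * N := by
    simpa [Chebyshev.psi] using Chebyshev.psi_le_const_mul_self hN0.le
  have e1 : ∑ n ∈ Finset.Ioc 0 N, Λ n * (N / n : ℕ) ≤ N * ∑ n ∈ Finset.Ioc 0 N, Λ n / n := by
    rw [Finset.mul_sum]
    refine Finset.sum_le_sum fun n _ ↦ ?_
    calc Λ n * (N / n : ℕ) ≤ Λ n * (N / n) :=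
          mul_le_mul_of_nonneg_left Nat.cast_div_le vonMangoldt_nonneg
      _ = _ := by ring
  have e2 : N * ∑ n ∈ Finset.Ioc 0 N, Λ n / n ≤
      ∑ n ∈ Finset.Ioc 0 N, Λ n * (N / n : ℕ) + ∑ n ∈ Finset.Ioc 0 N, Λ n := by
    rw [Finset.mul_sum, ← Finset.sum_add_distrib]
    refine Finset.sum_le_sum fun n hn ↦ ?_
    calc N * (Λ n / n) = Λ n * (N / n) := by ring
      _ ≤ Λ n * ((N / n : ℕ) + 1) := by
          refine mul_le_mul_of_nonneg_left ?_ vonMangoldt_nonneg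
          rw [← Nat.floor_div_eq_div (K := ℝ)]
          exact (Nat.lt_floor_add_one _).le
      _ = _ := by ring
  rw [hfac] at e1 e2
  rw [abs_le]
  constructor
  · have : N * (Real.log N - 1) ≤ N * ∑ n ∈ Finset.Ioc 0 N, Λ n / n := by linarith
    have := le_of_mul_le_mul_left this hN0
    have : 0 ≤ Real.log 4 := Real.log_nonneg (by norm_num)
    linarith
  · have : N * ∑ n ∈ Finset.Ioc 0 N, Λ n / n ≤ N * (Real.log N + (Real.log 4 + 4)) := by linarith
    have := le_of_mul_le_mul_left this hN0
    linarith

/-- The von Mangoldt function restricted to integers coprime to `q`. -/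
noncomputable def coprimeVonMangoldt (q n : ℕ) : ℝ := if n.Coprime q then Λ n else 0

lemma coprimeVonMangoldt_nonneg (q n : ℕ) : 0 ≤ coprimeVonMangoldt q n := by
  rw [coprimeVonMangoldt]
  split_ifs
  exacts [vonMangoldt_nonneg, le_rfl]

lemma coprimeVonMangoldt_le (q n : ℕ) : coprimeVonMangoldt q n ≤ Λ n := by
  rw [coprimeVonMangoldt]
  split_ifs
  exacts [le_rfl, vonMangoldt_nonneg]

lemma summable_vonMangoldt_sub_coprime_div (q : ℕ) [NeZero q] :
    Summable fun n : ℕ ↦ (Λ n - coprimeVonMangoldt q n) / n := by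
  have h1 : Summable fun n : ℕ ↦ (if n.Prime then 0 else Λ n) / n := by
    refine (vonMangoldt.summable_residueClass_non_primes_div (0 : ZMod 1)).congr fun n ↦ ?_
    have : vonMangoldt.residueClass (0 : ZMod 1) n = Λ n :=
      Set.indicator_of_mem (Set.mem_ofPred_eq ▸ Subsingleton.elim _ _) _
    rw [this]
  have h2 : Summable fun n : ℕ ↦ if n ∈ q.divisors then Λ n / n else 0 :=
    summable_of_hasFiniteSupport (q.divisors.finite_toSet.subset fun n hn ↦ by
      by_contra h
      exact hn (if_neg h))
  refine (h1.add h2).of_nonneg_of_le (fun n ↦ ?_) fun n ↦ ?_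
  · exact div_nonneg (sub_nonneg.2 (coprimeVonMangoldt_le q n)) n.cast_nonneg
  · have h0 : 0 ≤ Λ n / n := div_nonneg vonMangoldt_nonneg n.cast_nonneg
    have hi : 0 ≤ if n ∈ q.divisors then Λ n / n else 0 := by
      split_ifs
      exacts [h0, le_rfl]
    by_cases hp : n.Prime
    · by_cases hd : n ∣ q
      · rw [if_pos (Nat.mem_divisors.2 ⟨hd, NeZero.ne q⟩), if_pos hp, zero_div, zero_add]
        gcongr
        exact sub_le_self _ (coprimeVonMangoldt_nonneg q n)
      · rw [coprimeVonMangoldt, if_pos ((Nat.Prime.coprime_iff_not_dvd hp).2 hd), sub_self,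
          zero_div, if_pos hp, zero_div, zero_add]
        exact hi
    · rw [if_neg hp]
      have : (Λ n - coprimeVonMangoldt q n) / n ≤ Λ n / n := by
        gcongr
        exact sub_le_self _ (coprimeVonMangoldt_nonneg q n)
      linarith

lemma exists_abs_sum_coprimeVonMangoldt_div_sub_log_le (q : ℕ) [NeZero q] :
    ∃ B : ℝ, ∀ N : ℕ, N ≠ 0 →
      |∑ n ∈ Finset.Ioc 0 N, coprimeVonMangoldt q n / n - Real.log N| ≤ B := by
  have hS := summable_vonMangoldt_sub_coprime_div q
  refine ⟨Real.log 4 + 5 + ∑' n : ℕ, (Λ n - coprimeVonMangoldt q n) / n, fun N hN ↦ ?_⟩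
  have h1 := abs_sum_vonMangoldt_div_sub_log_le hN
  have hnn (n : ℕ) : 0 ≤ (Λ n - coprimeVonMangoldt q n) / n :=
    div_nonneg (sub_nonneg.2 (coprimeVonMangoldt_le q n)) n.cast_nonneg
  have h2 := hS.sum_le_tsum (Finset.Ioc 0 N) fun n _ ↦ hnn n
  have h3 : 0 ≤ ∑ n ∈ Finset.Ioc 0 N, (Λ n - coprimeVonMangoldt q n) / n :=
    Finset.sum_nonneg fun n _ ↦ hnn n
  have h4 : ∑ n ∈ Finset.Ioc 0 N, coprimeVonMangoldt q n / n =
      ∑ n ∈ Finset.Ioc 0 N, Λ n / n -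
        ∑ n ∈ Finset.Ioc 0 N, (Λ n - coprimeVonMangoldt q n) / n := by
    rw [← Finset.sum_sub_distrib]
    refine Finset.sum_congr rfl fun n _ ↦ by ring
  rw [abs_le] at h1 ⊢
  rw [h4]
  constructor <;> linarith [h1.1, h1.2]

/-- Comparison of `log log` with a sum of difference quotients. -/
lemma exists_tendsto_sum_log_sub_div_log_sub_log_log :
    ∃ c : ℝ, Tendsto (fun k : ℕ ↦ ∑ i ∈ Finset.range (k + 1),
      (Real.log (i + 2) - Real.log (i + 1)) / Real.log (i + 2) - Real.log (Real.log (k + 2)))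
      atTop (𝓝 c) := by
  set D : ℕ → ℝ := fun k : ℕ ↦ ∑ i ∈ Finset.range (k + 1),
      (Real.log (i + 2) - Real.log (i + 1)) / Real.log (i + 2) - Real.log (Real.log (k + 2)) with hD
  have step (k : ℕ) : D (k + 1) ≤ D k ∧
      D k - 1 / Real.log (k + 2) ≤ D (k + 1) - 1 / Real.log ((k + 1 : ℕ) + 2) := by
    set x := Real.log (k + 1 + 2) with hx
    set y := Real.log (k + 2) with hy
    have hk : (0 : ℝ) ≤ k := k.cast_nonneg
    have hy0 : 0 < y := Real.log_pos (by linarith)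
    have hxy : y ≤ x := Real.log_le_log (by linarith) (by linarith)
    have hx0 : 0 < x := hy0.trans_le hxy
    have hxy1 : x - y ≤ 1 := by
      rw [hx, hy, ← Real.log_div (by positivity) (by positivity)]
      refine (Real.log_le_sub_one_of_pos (by positivity)).trans ?_
      rw [sub_le_iff_le_add, div_le_iff₀ (by positivity)]
      linarith
    have e : D (k + 1) = D k + ((x - y) / x - (Real.log x - Real.log y)) := by
      simp only [hD]
      rw [Finset.sum_range_succ _ (k + 1)]
      push_cast
      rw [show (k : ℝ) + 1 + 1 = k + 2 by ring, ← hx, ← hy]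
      ring
    have l1 : (x - y) / x ≤ Real.log x - Real.log y := by
      rw [← Real.log_div hx0.ne' hy0.ne']
      have := Real.one_sub_inv_le_log_of_pos (div_pos hx0 hy0)
      rwa [inv_div, one_sub_div hx0.ne'] at this
    have l2 : Real.log x - Real.log y ≤ (x - y) / y := by
      rw [← Real.log_div hx0.ne' hy0.ne']
      have := Real.log_le_sub_one_of_pos (div_pos hx0 hy0)
      rwa [div_sub_one hy0.ne'] at this
    have l3 : (x - y) / y - (x - y) / x ≤ 1 / y - 1 / x := by
      have h1 : 1 / x ≤ 1 / y := one_div_le_one_div_of_le hy0 hxy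
      calc (x - y) / y - (x - y) / x = (x - y) * (1 / y - 1 / x) := by ring
        _ ≤ 1 * (1 / y - 1 / x) := mul_le_mul_of_nonneg_right hxy1 (by linarith)
        _ = _ := one_mul _
    push_cast
    rw [← hx, e]
    constructor <;> linarith
  have hanti : Antitone D := antitone_nat_of_succ_le fun k ↦ (step k).1
  have hmono : Monotone fun k : ℕ ↦ D k - 1 / Real.log (k + 2) :=
    monotone_nat_of_le_succ fun k ↦ (step k).2
  refine ⟨_, tendsto_atTop_ciInf hanti ⟨D 0 - 1 / Real.log ((0 : ℕ) + 2), ?_⟩⟩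
  rintro _ ⟨k, rfl⟩
  have h1 := hmono (Nat.zero_le k)
  have h2 : 0 ≤ 1 / Real.log ((k : ℝ) + 2) :=
    one_div_nonneg.2 (Real.log_nonneg (by linarith [(k.cast_nonneg : (0 : ℝ) ≤ k)]))
  simp only at h1
  linarith

/-- The sum `∑_{n ≤ x, (n, q) = 1} Λ(n) / (n log n)`. -/
noncomputable def mertensSum (q : ℕ) (x : ℝ) : ℝ :=
  ∑ n ∈ Finset.Icc 1 ⌊x⌋₊, coprimeVonMangoldt q n / Real.log n / n

lemma exists_tendsto_mertensSum_sub_log_log_nat (q : ℕ) [NeZero q] :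
    ∃ c : ℝ, Tendsto (fun k : ℕ ↦ mertensSum q ((k + 2 : ℕ) : ℝ) - Real.log (Real.log (k + 2)))
      atTop (𝓝 c) := by
  obtain ⟨B, hB⟩ := exists_abs_sum_coprimeVonMangoldt_div_sub_log_le q
  set z : ℕ → ℝ := fun i ↦
    coprimeVonMangoldt q (i + 2) / (i + 2) - (Real.log (i + 2) - Real.log (i + 1)) with hz
  have hone : coprimeVonMangoldt q 1 = 0 := by simp [coprimeVonMangoldt]
  have shift (g : ℕ → ℝ) (hg : g 1 = 0) (k : ℕ) :
      ∑ n ∈ Finset.Ioc 0 (k + 1), g n = ∑ i ∈ Finset.range k, g (i + 2) := by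
    induction k with
    | zero => simp [hg]
    | succ k ih =>
      rw [Finset.sum_range_succ, ← ih, ← Finset.insert_Ioc_right_eq_Ioc_add_one (Nat.zero_le (k + 1)),
        Finset.sum_insert (by simp), add_comm]
      rfl
  have hzsum (k : ℕ) : ∑ i ∈ Finset.range k, z i =
      ∑ n ∈ Finset.Ioc 0 (k + 1), coprimeVonMangoldt q n / n - Real.log (k + 1 : ℕ) := by
    rw [shift _ (by simp [hone]), hz, Finset.sum_sub_distrib]
    have := Finset.sum_range_sub (fun i : ℕ ↦ Real.log (i + 1)) k
    push_cast at this ⊢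
    simp only [add_assoc, one_add_one_eq_two, zero_add, Real.log_one, sub_zero] at this ⊢
    rw [this]
  have hanti : Antitone fun i : ℕ ↦ 1 / Real.log (i + 2) := by
    intro i j hij
    have hi : (0 : ℝ) ≤ i := i.cast_nonneg
    have hij' : (i : ℝ) ≤ j := by exact_mod_cast hij
    exact one_div_le_one_div_of_le (Real.log_pos (by linarith))
      (Real.log_le_log (by linarith) (by linarith))
  have hzero : Tendsto (fun i : ℕ ↦ 1 / Real.log (i + 2)) atTop (𝓝 0) := by
    simp only [one_div]
    exact tendsto_inv_atTop_zero.comp (Real.tendsto_log_atTop.comp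
      (tendsto_atTop_add_const_right _ _ tendsto_natCast_atTop_atTop))
  obtain ⟨c₁, hc₁⟩ := cauchySeq_tendsto_of_complete
    (hanti.cauchySeq_series_mul_of_tendsto_zero_of_bounded hzero (z := z) (b := B) fun k ↦ by
      rw [hzsum, Real.norm_eq_abs]
      exact hB _ (Nat.succ_ne_zero k))
  obtain ⟨c₂, hc₂⟩ := exists_tendsto_sum_log_sub_div_log_sub_log_log
  refine ⟨c₁ + c₂, ((hc₁.comp (tendsto_add_atTop_nat 1)).add hc₂).congr fun k ↦ ?_⟩
  have hIcc : Finset.Icc 1 (k + 2) = Finset.Ioc 0 (k + 1 + 1) := by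
    ext n
    simp only [Finset.mem_Icc, Finset.mem_Ioc]
    omega
  rw [mertensSum, Nat.floor_natCast, hIcc, shift _ (by simp [hone])]
  simp only [Function.comp_apply, smul_eq_mul]
  rw [← add_sub_assoc, ← Finset.sum_add_distrib]
  congr 1
  refine Finset.sum_congr rfl fun i _ ↦ ?_
  simp only [hz]
  push_cast
  ring

lemma integrableOn_exp_neg_mul_abs_log :
    IntegrableOn (fun v : ℝ ↦ Real.exp (-v) * |Real.log v|) (Set.Ioi 0) := by
  have h1 := Real.GammaIntegral_convergent (s := 2) (by norm_num)
  have h2 := Real.GammaIntegral_convergent (s := 1 / 2) (by norm_num)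
  refine (h1.add (h2.const_mul 2)).mono' (by fun_prop) ?_
  filter_upwards [ae_restrict_mem measurableSet_Ioi] with v hv
  have hv0 : 0 < v := hv
  have h3 : |Real.log v| ≤ v ^ (2 - 1 : ℝ) + 2 * v ^ (1 / 2 - 1 : ℝ) := by
    have hp : (2 - 1 : ℝ) = 1 := by norm_num
    have hn : (1 / 2 - 1 : ℝ) = -(1 / 2) := by norm_num
    rw [hp, hn, Real.rpow_one, abs_le]
    have h4 : 0 ≤ v ^ (-(1 / 2) : ℝ) := by positivity
    have h5 := Real.log_le_rpow_div (x := v⁻¹) (by positivity) (ε := 1 / 2) (by norm_num)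
    rw [Real.log_inv, Real.inv_rpow hv0.le, ← Real.rpow_neg hv0.le] at h5
    constructor <;> linarith [Real.log_le_self hv0.le]
  rw [norm_mul, norm_abs_eq_norm, Real.norm_of_nonneg (Real.exp_pos _).le, Real.norm_eq_abs]
  calc _ ≤ Real.exp (-v) * (v ^ (2 - 1 : ℝ) + 2 * v ^ (1 / 2 - 1 : ℝ)) := by gcongr
    _ = _ := by
      simp only [Pi.add_apply]
      ring

lemma integrableOn_exp_neg_mul_log :
    IntegrableOn (fun v : ℝ ↦ Real.exp (-v) * Real.log v) (Set.Ioi 0) := by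
  refine Integrable.mono' integrableOn_exp_neg_mul_abs_log (by fun_prop) (Eventually.of_forall fun v ↦ ?_)
  rw [norm_mul, Real.norm_of_nonneg (Real.exp_pos _).le, Real.norm_eq_abs]

lemma integral_exp_neg_mul_log :
    ∫ v in Set.Ioi (0 : ℝ), Real.exp (-v) * Real.log v = -Real.eulerMascheroniConstant := by
  have h1 := Complex.hasDerivAt_GammaIntegral (s := 1) (by simp)
  have h2 : Complex.Gamma =ᶠ[𝓝 1] Complex.GammaIntegral := by
    filter_upwards [(Complex.isOpen_re_gt 0).mem_nhds (show (1 : ℂ) ∈ _ by simp)] with s hs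
    exact Complex.Gamma_eq_integral hs
  have h3 := (h1.congr_of_eventuallyEq h2).unique Complex.hasDerivAt_Gamma_one
  have h4 : ((∫ v in Set.Ioi (0 : ℝ), Real.exp (-v) * Real.log v : ℝ) : ℂ) =
      -Real.eulerMascheroniConstant := by
    rw [← h3, ← integral_complex_ofReal]
    refine setIntegral_congr_fun measurableSet_Ioi fun v _ ↦ ?_
    simp [mul_comm]
  exact_mod_cast h4

lemma mertensSum_mono (q : ℕ) : Monotone (mertensSum q) := by
  intro x y hxy
  refine Finset.sum_le_sum_of_subset_of_nonneg
    (Finset.Icc_subset_Icc_right (Nat.floor_le_floor hxy)) fun n _ _ ↦ ?_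
  exact div_nonneg (div_nonneg (coprimeVonMangoldt_nonneg q n) (Real.log_natCast_nonneg n))
    n.cast_nonneg

lemma mertensSum_nonneg (q : ℕ) (x : ℝ) : 0 ≤ mertensSum q x :=
  Finset.sum_nonneg fun n _ ↦ div_nonneg
    (div_nonneg (coprimeVonMangoldt_nonneg q n) (Real.log_natCast_nonneg n)) n.cast_nonneg

lemma exists_tendsto_mertensSum_exp_sub_log (q : ℕ) [NeZero q] :
    ∃ c : ℝ, Tendsto (fun u ↦ mertensSum q (Real.exp u) - Real.log u) atTop (𝓝 c) := by
  obtain ⟨c, hc⟩ := exists_tendsto_mertensSum_sub_log_log_nat q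
  refine ⟨c, ?_⟩
  set N : ℝ → ℕ := fun u ↦ ⌊Real.exp u⌋₊ with hN
  have hNt : Tendsto N atTop atTop := tendsto_nat_floor_atTop.comp Real.tendsto_exp_atTop
  have h1 := hc.comp ((tendsto_sub_atTop_nat 2).comp hNt)
  have h2 : Tendsto (fun u : ℝ ↦ Real.log (N u) / u) atTop (𝓝 1) := by
    have h3 : Tendsto (fun u : ℝ ↦ 1 - Real.log 2 / u) atTop (𝓝 1) := by
      simpa using (tendsto_const_nhds (x := (1 : ℝ))).sub
        (tendsto_const_nhds.div_atTop (tendsto_id (α := ℝ)))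
    refine tendsto_of_tendsto_of_tendsto_of_le_of_le' h3 tendsto_const_nhds ?_ ?_
    · filter_upwards [eventually_gt_atTop 1] with u hu
      have h4 : Real.exp u / 2 ≤ N u := by
        have := Nat.lt_floor_add_one (Real.exp u)
        have := Real.add_one_le_exp u
        simp only [hN]
        linarith
      have h5 := Real.log_le_log (by positivity) h4
      rw [Real.log_div (by positivity) (by norm_num), Real.log_exp] at h5
      rw [one_sub_div (by linarith)]
      gcongr
    · filter_upwards [eventually_gt_atTop 1] with u hu
      rw [div_le_one (by linarith)]
      have h4 : (1 : ℝ) ≤ N u := by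
        exact_mod_cast Nat.le_floor (by exact_mod_cast Real.one_le_exp (by linarith))
      have h5 := Real.log_le_log (by linarith) (Nat.floor_le (Real.exp_pos u).le)
      rwa [Real.log_exp] at h5
  have h6 : Tendsto (fun u : ℝ ↦ Real.log (Real.log (N u) / u)) atTop (𝓝 0) := by
    simpa using h2.log one_ne_zero
  have h7 := h1.add h6
  rw [add_zero] at h7
  refine h7.congr' ?_
  filter_upwards [hNt.eventually_ge_atTop 2, eventually_gt_atTop 0] with u hu hu0
  have h8 : (N u - 2 + 2 : ℕ) = N u := by omega
  have h9 : ((N u - 2 : ℕ) : ℝ) + 2 = N u := by exact_mod_cast h8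
  have h10 : 0 < Real.log (N u) := Real.log_pos (by exact_mod_cast hu)
  simp only [Function.comp_apply, h8, h9]
  rw [Real.log_div h10.ne' hu0.ne', mertensSum, Nat.floor_natCast, mertensSum]
  ring

lemma exists_abs_mertensSum_exp_sub_log_le (q : ℕ) [NeZero q] :
    ∃ K : ℝ, 0 ≤ K ∧ ∀ u : ℝ, 0 < u →
      |mertensSum q (Real.exp u) - Real.log u| ≤ K + max (-Real.log u) 0 := by
  obtain ⟨c, hc⟩ := exists_tendsto_mertensSum_exp_sub_log q
  obtain ⟨U, hU⟩ := eventually_atTop.1 (hc.abs.eventually_le_const (lt_add_one |c|))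
  set V := max U 1 with hV
  have hM := mertensSum_nonneg q (Real.exp V)
  have hlV : 0 ≤ Real.log V := Real.log_nonneg (le_max_right _ _)
  refine ⟨|c| + 1 + (mertensSum q (Real.exp V) + Real.log V), by positivity, fun u hu ↦ ?_⟩
  rcases le_or_gt V u with h | h
  · have := hU u ((le_max_left _ _).trans h)
    linarith [le_max_right (-Real.log u) 0]
  · have h1 : mertensSum q (Real.exp u) ≤ mertensSum q (Real.exp V) :=
      mertensSum_mono q (Real.exp_le_exp.2 h.le)
    have h2 := mertensSum_nonneg q (Real.exp u)
    have h3 : Real.log u ≤ Real.log V := Real.log_le_log hu h.le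
    rw [abs_le]
    constructor <;> linarith [le_max_right (-Real.log u) 0, le_max_left (-Real.log u) 0, abs_nonneg c]

lemma logCoeff_one (q n : ℕ) : logCoeff (1 : DirichletCharacter ℂ q) n =
    ((coprimeVonMangoldt q n / Real.log n : ℝ) : ℂ) := by
  rw [logCoeff, coprimeVonMangoldt]
  by_cases h : n.Coprime q
  · rw [MulChar.one_apply ((ZMod.isUnit_iff_coprime n q).2 h), if_pos h, one_mul]
  · rw [MulChar.map_nonunit _ (mt (ZMod.isUnit_iff_coprime n q).1 h), if_neg h]
    simp

lemma norm_logCoeff_le_coprimeVonMangoldt {q : ℕ} (χ : DirichletCharacter ℂ q) (n : ℕ) :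
    ‖logCoeff χ n‖ ≤ coprimeVonMangoldt q n / Real.log n := by
  by_cases h : n.Coprime q
  · rw [coprimeVonMangoldt, if_pos h]
    exact norm_logCoeff_le χ n
  · rw [logCoeff, MulChar.map_nonunit _ (mt (ZMod.isUnit_iff_coprime n q).1 h), zero_mul, norm_zero]
    exact div_nonneg (coprimeVonMangoldt_nonneg q n) (Real.log_natCast_nonneg n)

lemma LFunction_one_eq_exp_tsum (q : ℕ) [NeZero q] {δ : ℝ} (hδ : 0 < δ) :
    (Summable fun n : ℕ ↦ coprimeVonMangoldt q n / Real.log n / n * Real.exp (-(δ * Real.log n))) ∧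
    LFunction (1 : DirichletCharacter ℂ q) (1 + δ) = (Real.exp (∑' n : ℕ,
      coprimeVonMangoldt q n / Real.log n / n * Real.exp (-(δ * Real.log n))) : ℝ) := by
  have hre : 1 < ((1 : ℂ) + δ).re := by simpa using hδ
  have hterm (n : ℕ) : LSeries.term (logCoeff (1 : DirichletCharacter ℂ q)) (1 + δ) n =
      ((coprimeVonMangoldt q n / Real.log n / n * Real.exp (-(δ * Real.log n)) : ℝ) : ℂ) := by
    rcases eq_or_ne n 0 with rfl | hn
    · simp
    · have hn0 : (0 : ℝ) < n := by exact_mod_cast hn.bot_lt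
      have e : (n : ℂ) ^ (1 + δ : ℂ) = ((n * Real.exp (δ * Real.log n) : ℝ) : ℂ) := by
        rw [mul_comm δ, ← Real.rpow_def_of_pos hn0, cpow_add _ _ (by exact_mod_cast hn), cpow_one,
          ofReal_mul, ofReal_cpow hn0.le, ofReal_natCast]
      rw [LSeries.term_of_ne_zero hn, logCoeff_one, e, ← ofReal_div, Real.exp_neg]
      congr 1
      field_simp
  have hs := LSeriesSummable_of_abscissaOfAbsConv_lt_re
    (abscissaOfAbsConv_logCoeff_lt (1 : DirichletCharacter ℂ q) hre)
  rw [LSeriesSummable, summable_congr hterm, summable_ofReal] at hs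
  refine ⟨hs, ?_⟩
  rw [← exp_LSeries_logCoeff _ hre, LSeries, tsum_congr hterm, ← ofReal_tsum, ofReal_exp]

lemma integral_exp_neg_mul_mertensSum (q : ℕ) [NeZero q] {δ : ℝ} (hδ : 0 < δ) :
    ∫ v in Set.Ioi (0 : ℝ), Real.exp (-v) * mertensSum q (Real.exp (v / δ)) =
      ∑' n : ℕ, coprimeVonMangoldt q n / Real.log n / n * Real.exp (-(δ * Real.log n)) := by
  set w : ℕ → ℝ := fun n ↦ coprimeVonMangoldt q n / Real.log n / n with hw
  have hw0 (n : ℕ) : 0 ≤ w n := div_nonneg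
    (div_nonneg (coprimeVonMangoldt_nonneg q n) (Real.log_natCast_nonneg n)) n.cast_nonneg
  set F : ℕ → ℝ → ℝ := fun n v ↦
    w n * (Set.Ici (δ * Real.log n)).indicator (fun v ↦ Real.exp (-v)) v with hF
  have hF0 (n : ℕ) (v : ℝ) : 0 ≤ F n v :=
    mul_nonneg (hw0 n) (Set.indicator_nonneg (fun _ _ ↦ (Real.exp_pos _).le) v)
  have hexp : IntegrableOn (fun v : ℝ ↦ Real.exp (-v)) (Set.Ioi 0) := by
    simpa using exp_neg_integrableOn_Ioi 0 one_pos
  have hint (n : ℕ) : Integrable (F n) (volume.restrict (Set.Ioi 0)) :=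
    (Integrable.indicator hexp measurableSet_Ici).const_mul _
  have hval (n : ℕ) : ∫ v in Set.Ioi (0 : ℝ), F n v = w n * Real.exp (-(δ * Real.log n)) := by
    rcases le_or_gt n 1 with hn | hn
    · have : w n = 0 := by
        interval_cases n <;> simp [hw]
      simp [hF, this]
    · have hlog : 0 < δ * Real.log n := mul_pos hδ (Real.log_pos (by exact_mod_cast hn))
      have hinter : Set.Ioi (0 : ℝ) ∩ Set.Ici (δ * Real.log n) = Set.Ici (δ * Real.log n) :=
        Set.inter_eq_right.2 fun v hv ↦ hlog.trans_le hv
      simp only [hF]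
      rw [integral_const_mul, setIntegral_indicator measurableSet_Ici, hinter,
        integral_Ici_eq_integral_Ioi, integral_exp_neg_Ioi]
  have hsum : Summable fun n ↦ ∫ v in Set.Ioi (0 : ℝ), ‖F n v‖ := by
    simp only [Real.norm_of_nonneg (hF0 _ _), hval]
    exact (LFunction_one_eq_exp_tsum q hδ).1
  have h := hasSum_integral_of_summable_integral_norm hint hsum
  simp only [hval] at h
  rw [h.tsum_eq]
  refine setIntegral_congr_fun measurableSet_Ioi fun v hv ↦ ?_
  show _ = ∑' n, F n v
  rw [tsum_eq_sum (s := Finset.Icc 1 ⌊Real.exp (v / δ)⌋₊), mertensSum, Finset.mul_sum]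
  · refine Finset.sum_congr rfl fun n hn ↦ ?_
    have hn1 := Finset.mem_Icc.1 hn
    have hn0 : (0 : ℝ) < n := by exact_mod_cast hn1.1
    have h2 : δ * Real.log n ≤ v := by
      rw [mul_comm, ← le_div_iff₀ hδ, Real.log_le_iff_le_exp hn0]
      exact (Nat.le_floor_iff (Real.exp_pos _).le).1 hn1.2
    simp only [hF]
    rw [Set.indicator_of_mem (Set.mem_Ici.2 h2), mul_comm]
  · intro n hn
    rcases Nat.eq_zero_or_pos n with rfl | hn1
    · simp [hF, hw]
    · have hn0 : (0 : ℝ) < n := by exact_mod_cast hn1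
      have h2 : ¬ δ * Real.log n ≤ v := by
        rw [mul_comm, ← le_div_iff₀ hδ, Real.log_le_iff_le_exp hn0]
        exact fun h ↦ hn (Finset.mem_Icc.2 ⟨hn1, Nat.le_floor h⟩)
      simp only [hF]
      rw [Set.indicator_of_notMem (by simpa using h2), mul_zero]

lemma tendsto_log_mul_LFunction_one (q : ℕ) [NeZero q] :
    Tendsto (fun δ : ℝ ↦ ∑' n : ℕ, coprimeVonMangoldt q n / Real.log n / n *
      Real.exp (-(δ * Real.log n)) + Real.log δ) (𝓝[>] 0)
      (𝓝 (Real.log ((q.totient : ℝ) / q))) := by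
  have hq : (q : ℝ) ≠ 0 := by exact_mod_cast NeZero.ne q
  have htot : ∏ p ∈ q.primeFactors, (1 - (p : ℂ)⁻¹) = (((q.totient : ℝ) / q : ℝ) : ℂ) := by
    have h1 : (q.totient : ℂ) = q * ∏ p ∈ q.primeFactors, (1 - (p : ℂ)⁻¹) := by
      simpa using congrArg (Rat.cast : ℚ → ℂ) (Nat.totient_eq_mul_prod_factors q)
    have hqc : (q : ℂ) ≠ 0 := by exact_mod_cast NeZero.ne q
    push_cast
    rw [h1, mul_div_cancel_left₀ _ hqc]
  have hlim : Tendsto (fun δ : ℝ ↦ (1 + δ : ℂ)) (𝓝[>] 0) (𝓝[≠] 1) := by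
    refine tendsto_nhdsWithin_iff.2 ⟨?_, ?_⟩
    · have : Tendsto (fun δ : ℝ ↦ (1 + δ : ℂ)) (𝓝 0) (𝓝 (1 + (0 : ℝ))) :=
        Continuous.tendsto (by fun_prop) 0
      simpa using this.mono_left nhdsWithin_le_nhds
    · filter_upwards [self_mem_nhdsWithin] with δ hδ
      simpa using (ne_of_gt hδ : δ ≠ 0)
  have h := (LFunctionTrivChar_residue_one (N := q)).comp hlim
  rw [htot] at h
  have h' := (Complex.continuous_re.tendsto _).comp h
  have hpos : (q.totient : ℝ) / q ≠ 0 :=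
    div_ne_zero (by exact_mod_cast (Nat.totient_pos.2 (NeZero.pos q)).ne') hq
  rw [ofReal_re] at h'
  refine (h'.log hpos).congr' ?_
  filter_upwards [self_mem_nhdsWithin] with δ hδ
  have hδ0 : 0 < δ := hδ
  simp only [Function.comp_apply, LFunctionTrivChar]
  rw [(LFunction_one_eq_exp_tsum q hδ0).2, add_sub_cancel_left, ← ofReal_mul, ofReal_re,
    Real.log_mul hδ0.ne' (Real.exp_pos _).ne', Real.log_exp, add_comm]

/-- **Mertens' third theorem**, with a coprimality condition. -/
lemma tendsto_mertensSum_exp_sub_log (q : ℕ) [NeZero q] :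
    Tendsto (fun u ↦ mertensSum q (Real.exp u) - Real.log u) atTop
      (𝓝 (Real.eulerMascheroniConstant + Real.log ((q.totient : ℝ) / q))) := by
  obtain ⟨c, hc⟩ := exists_tendsto_mertensSum_exp_sub_log q
  obtain ⟨K, hK0, hK⟩ := exists_abs_mertensSum_exp_sub_log_le q
  set E : ℝ → ℝ := fun u ↦ mertensSum q (Real.exp u) - Real.log u with hE
  have hmeas : Measurable E :=
    ((mertensSum_mono q).comp Real.exp_monotone).measurable.sub Real.measurable_log
  have hexp : IntegrableOn (fun v : ℝ ↦ Real.exp (-v)) (Set.Ioi 0) := by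
    simpa using exp_neg_integrableOn_Ioi 0 one_pos
  have hexp1 : ∫ v in Set.Ioi (0 : ℝ), Real.exp (-v) = 1 := by
    simpa using integral_exp_neg_Ioi 0
  have hdom : IntegrableOn (fun v : ℝ ↦ Real.exp (-v) * K + Real.exp (-v) * |Real.log v|)
      (Set.Ioi 0) := (hexp.mul_const K).add integrableOn_exp_neg_mul_abs_log
  have hbound {δ : ℝ} (hδ : 0 < δ) (hδ1 : δ ≤ 1) {v : ℝ} (hv : 0 < v) :
      ‖Real.exp (-v) * E (v / δ)‖ ≤ Real.exp (-v) * K + Real.exp (-v) * |Real.log v| := by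
    rw [norm_mul, Real.norm_of_nonneg (Real.exp_pos _).le, ← mul_add, Real.norm_eq_abs]
    refine mul_le_mul_of_nonneg_left ((hK _ (by positivity)).trans ?_) (Real.exp_pos _).le
    gcongr
    refine max_le ?_ (abs_nonneg _)
    rw [Real.log_div hv.ne' hδ.ne']
    linarith [Real.log_nonpos hδ.le hδ1, neg_abs_le (Real.log v)]
  have hsmall : ∀ᶠ δ : ℝ in 𝓝[>] 0, 0 < δ ∧ δ ≤ 1 := by
    filter_upwards [Ioc_mem_nhdsGT (zero_lt_one (α := ℝ))] with δ hδ using hδ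
  have hm (δ : ℝ) : Measurable fun v ↦ Real.exp (-v) * E (v / δ) :=
    (by fun_prop : Measurable fun v : ℝ ↦ Real.exp (-v)).mul (hmeas.comp (by fun_prop))
  have hlim : Tendsto (fun δ : ℝ ↦ ∫ v in Set.Ioi (0 : ℝ), Real.exp (-v) * E (v / δ)) (𝓝[>] 0)
      (𝓝 (∫ v in Set.Ioi (0 : ℝ), Real.exp (-v) * c)) := by
    refine tendsto_integral_filter_of_dominated_convergence _
      (Eventually.of_forall fun δ ↦ (hm δ).aestronglyMeasurable) ?_ hdom ?_
    · filter_upwards [hsmall] with δ hδ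
      filter_upwards [ae_restrict_mem measurableSet_Ioi] with v hv using hbound hδ.1 hδ.2 hv
    · filter_upwards [ae_restrict_mem measurableSet_Ioi] with v hv
      refine (hc.comp ?_).const_mul _
      exact tendsto_inv_nhdsGT_zero.const_mul_atTop hv
  rw [integral_mul_const, hexp1, one_mul] at hlim
  have hlim' := (tendsto_log_mul_LFunction_one q).add_const Real.eulerMascheroniConstant
  have heq : c = Real.log ((q.totient : ℝ) / q) + Real.eulerMascheroniConstant := by
    refine tendsto_nhds_unique hlim (hlim'.congr' ?_)
    filter_upwards [hsmall] with δ ⟨hδ, hδ1⟩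
    have hEi : IntegrableOn (fun v ↦ Real.exp (-v) * E (v / δ)) (Set.Ioi 0) :=
      Integrable.mono' hdom (hm δ).aestronglyMeasurable (by
        filter_upwards [ae_restrict_mem measurableSet_Ioi] with v hv using hbound hδ hδ1 hv)
    have hli : IntegrableOn (fun v ↦ Real.exp (-v) * Real.log v - Real.exp (-v) * Real.log δ)
        (Set.Ioi 0) := integrableOn_exp_neg_mul_log.sub (hexp.mul_const _)
    have e : ∫ v in Set.Ioi (0 : ℝ), Real.exp (-v) * mertensSum q (Real.exp (v / δ)) =
        (∫ v in Set.Ioi (0 : ℝ), Real.exp (-v) * E (v / δ)) +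
        ∫ v in Set.Ioi (0 : ℝ), (Real.exp (-v) * Real.log v - Real.exp (-v) * Real.log δ) := by
      rw [← integral_add hEi hli]
      refine setIntegral_congr_fun measurableSet_Ioi fun v hv ↦ ?_
      simp only [hE]
      rw [Real.log_div (ne_of_gt hv) hδ.ne']
      ring
    rw [integral_exp_neg_mul_mertensSum q hδ, integral_sub integrableOn_exp_neg_mul_log
      (hexp.mul_const _), integral_exp_neg_mul_log, integral_mul_const, hexp1] at e
    rw [e]
    ring
  rwa [heq, add_comm] at hc

lemma DirichletCharacter.IsPrimitive.ne_one {q : ℕ} [NeZero q] (hq : q ≠ 1)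
    {χ : DirichletCharacter ℂ q} (hχ : χ.IsPrimitive) : χ ≠ 1 := by
  rintro rfl
  exact hq (((isPrimitive_def _).1 hχ).symm.trans conductor_one)

lemma exists_norm_LFunction_le_log_log {q : ℕ} [NeZero q] {χ : DirichletCharacter ℂ q} (hχ : χ ≠ 1)
    (hne : ∀ s : ℂ, 1 / 2 < s.re → LFunction χ s ≠ 0) {ε : ℝ} (hε : 0 < ε) :
    ∃ T₀ : ℝ, 4 ≤ T₀ ∧ ∀ s : ℂ, 1 ≤ s.re → T₀ ≤ s.im → ‖LFunction χ s‖ ≤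
      (2 * Real.exp Real.eulerMascheroniConstant * (q.totient : ℝ) / q + ε) *
        Real.log (Real.log s.im) := by
  obtain ⟨f, hf, hexp, hser⟩ := exists_log_LFunction hχ hne
  have hφ : 0 < (q.totient : ℝ) / q :=
    div_pos (by exact_mod_cast Nat.totient_pos.2 (NeZero.pos q)) (by exact_mod_cast NeZero.pos q)
  set D : ℝ := Real.exp Real.eulerMascheroniConstant * ((q.totient : ℝ) / q) with hD
  have hD0 : 0 < D := by positivity
  set η : ℝ := Real.log (1 + ε / (2 * D)) / 2 with hη
  have h1 : 1 < 1 + ε / (2 * D) := by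
    have : 0 < ε / (2 * D) := by positivity
    linarith
  have hη0 : 0 < η := half_pos (Real.log_pos h1)
  have hηexp : 2 * Real.exp η * (D * Real.exp η) = 2 * D + ε := by
    have : Real.exp η * Real.exp η = 1 + ε / (2 * D) := by
      rw [← Real.exp_add, hη, add_halves, Real.exp_log (by linarith)]
    calc _ = 2 * D * (Real.exp η * Real.exp η) := by ring
      _ = _ := by rw [this]; field_simp
  set κ : ℝ := 2 * Real.exp η with hκ
  have hκ2 : 2 < κ := by linarith [Real.one_lt_exp_iff.2 hη0]
  set b : ℝ := (1 / κ + 1 / 2) / 2 with hb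
  have hκi : 1 / κ < 1 / 2 := one_div_lt_one_div_of_lt two_pos hκ2
  have hκi0 : 0 < 1 / κ := by positivity
  have hκb : 0 < κ * b - 1 := by
    have : κ * b - 1 = (κ - 2) / 4 := by
      rw [hb]
      field_simp
      ring
    linarith
  obtain ⟨C, hC, hsum⟩ := norm_log_LFunction_le_sum hχ hf hexp hser (b := b) (by positivity)
    (by linarith)
  have hll : Tendsto (fun t : ℝ ↦ Real.log (Real.log t)) atTop atTop :=
    Real.tendsto_log_atTop.comp Real.tendsto_log_atTop
  have hmain : ∀ᶠ t : ℝ in atTop, mertensSum q (Real.exp (κ * Real.log (Real.log t))) -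
      Real.log (κ * Real.log (Real.log t)) <
        Real.eulerMascheroniConstant + Real.log ((q.totient : ℝ) / q) + η / 2 :=
    ((tendsto_mertensSum_exp_sub_log q).comp (hll.const_mul_atTop (by linarith))).eventually_lt_const
      (by linarith)
  have herr : ∀ᶠ t : ℝ in atTop, C * Real.log t ^ (-(κ * b - 1)) < η / 2 := by
    have := ((tendsto_rpow_neg_atTop hκb).comp Real.tendsto_log_atTop).const_mul C
    rw [mul_zero] at this
    exact this.eventually_lt_const (by linarith)
  obtain ⟨T, hT⟩ := eventually_atTop.1 (hmain.and (herr.and (hll.eventually_gt_atTop 0)))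
  refine ⟨max T 4, le_max_right _ _, fun s hs hsT ↦ ?_⟩
  obtain ⟨hm, he, hl⟩ := hT s.im ((le_max_left _ _).trans hsT)
  have hs4 : 4 ≤ s.im := (le_max_right _ _).trans hsT
  have hlog : 0 < Real.log s.im := Real.log_pos (by linarith)
  set u : ℝ := κ * Real.log (Real.log s.im) with hu
  have hu0 : 0 < u := by positivity
  have hx : Real.log s.im * Real.exp u ^ (-b) = Real.log s.im ^ (-(κ * b - 1)) := by
    rw [← Real.exp_mul, Real.rpow_def_of_pos hlog, hu]
    nth_rewrite 1 [← Real.exp_log hlog]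
    rw [← Real.exp_add]
    ring_nf
  have hfs : ‖f s‖ ≤ Real.log u + Real.eulerMascheroniConstant +
      Real.log ((q.totient : ℝ) / q) + η := by
    have h2 := hsum s (Real.exp u) hs4 hs (Real.one_le_exp hu0.le)
    rw [mul_assoc, hx] at h2
    have h3 : ∑ n ∈ Finset.Icc 1 ⌊Real.exp u⌋₊, ‖logCoeff χ n‖ / n ≤ mertensSum q (Real.exp u) :=
      Finset.sum_le_sum fun n _ ↦ by
        gcongr
        exact norm_logCoeff_le_coprimeVonMangoldt χ n
    linarith
  rw [← hexp s (by linarith), Complex.norm_exp]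
  calc Real.exp (f s).re ≤ Real.exp (Real.log u + Real.eulerMascheroniConstant +
        Real.log ((q.totient : ℝ) / q) + η) :=
        Real.exp_le_exp.2 ((Complex.re_le_norm _).trans hfs)
    _ = κ * (D * Real.exp η) * Real.log (Real.log s.im) := by
        rw [Real.exp_add, Real.exp_add, Real.exp_add, Real.exp_log hu0, Real.exp_log hφ, hu, hD]
        ring
    _ = _ := by
        rw [hηexp, hD]
        ring

end LogLFunction

/-- Assuming GRH for `χ`, uniformly for `σ ≥ 1`,
`|L(σ+it,χ)| ≤ (2 e^{C₀} φ(q)/q + ε) log log t` for all large `t`. -/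
theorem classical_upper_bound_on_one_line (q : ℕ) [NeZero q] (hq : 2 < q)
    (χ : DirichletCharacter ℂ q) (hχ : χ.IsPrimitive)
    (hGRH : ∀ s : ℂ, LFunction χ s = 0 → 0 < s.re → s.re < 1 → s.re = 1 / 2) :
    ∀ ε : ℝ, 0 < ε → ∃ T₀ : ℝ, 4 ≤ T₀ ∧
      ∀ σ t : ℝ, 1 ≤ σ → T₀ ≤ t →
        ‖LFunction χ (σ + t * I)‖ ≤
          (2 * Real.exp Real.eulerMascheroniConstant * (Nat.totient q : ℝ) / q + ε) *
            Real.log (Real.log t) := by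
  have hχ1 : χ ≠ 1 := hχ.ne_one (by omega)
  have hne (s : ℂ) (hs : 1 / 2 < s.re) : LFunction χ s ≠ 0 := by
    rcases lt_or_ge s.re 1 with h | h
    · exact fun h0 ↦ hs.ne' (hGRH s h0 (by linarith) h)
    · exact LFunction_ne_zero_of_one_le_re χ (.inl hχ1) h
  intro ε hε
  obtain ⟨T₀, hT₀, hT⟩ := exists_norm_LFunction_le_log_log hχ1 hne hε
  exact ⟨T₀, hT₀, fun σ t hσ ht ↦ by simpa using hT (σ + t * I) (by simpa) (by simpa)⟩
end

section
/- There is an absolute constant C > 0 such that for every completely multiplicative function a : ℕ → ℂ satisfying |a(p)| ≤ 1 for all primes p, every real x ≥ 2, and every s ∈ ℂ with Re(s) ≥ 1, one has |∑_{1 < n ≤ x} Λ(n)·a(n)/(n^s·log n) − ∑_{p ≤ x, p prime} (−log(1 − a(p)/p^s))| ≤ C/(√x·log x), where log denotes the principal branch of the complex logarithm. -/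
open Complex ArithmeticFunction Finset

/-- A sum over prime powers up to `N`, organised by the underlying prime. -/
lemma sum_primePow_eq_sum_prime_sum_exponent {R : Type*} [AddCommMonoid R] (f : ℕ → R) (N : ℕ) :
    ∑ n ∈ (Finset.Ioc 1 N).filter IsPrimePow, f n =
      ∑ p ∈ (Finset.Icc 1 N).filter Nat.Prime, ∑ k ∈ Finset.Icc 1 (Nat.log p N), f (p ^ k) := by
  rw [Finset.sum_sigma']
  symm
  refine Finset.sum_bij (fun q _ => q.1 ^ q.2) ?_ ?_ ?_ fun _ _ => rfl
  · rintro ⟨p, k⟩ h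
    simp only [mem_sigma, mem_filter, mem_Icc, mem_Ioc] at h ⊢
    obtain ⟨⟨⟨-, hpN⟩, hp⟩, hk1, hk⟩ := h
    have hk0 : k ≠ 0 := by lia
    exact ⟨⟨Nat.one_lt_pow hk0 hp.one_lt, Nat.pow_le_of_le_log (by have := hp.pos; lia) hk⟩,
      hp.isPrimePow.pow hk0⟩
  · rintro ⟨p, k⟩ h ⟨q, l⟩ h' e
    simp only [mem_sigma, mem_filter, mem_Icc] at h h' e
    obtain ⟨rfl, rfl⟩ := h.1.2.pow_inj' h'.1.2 (by lia) (by lia) e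
    rfl
  · intro n h
    simp only [mem_filter, mem_Ioc] at h
    obtain ⟨⟨-, hn⟩, p, k, hp, hk, rfl⟩ := h
    have hp' := hp.nat_prime
    refine ⟨⟨p, k⟩, ?_, rfl⟩
    simp only [mem_sigma, mem_filter, mem_Icc]
    have hpN : p ≤ N := (Nat.le_self_pow hk.ne' p).trans hn
    refine ⟨⟨⟨hp'.one_le, hpN⟩, hp'⟩, hk, ?_⟩
    exact Nat.le_log_of_pow_le hp'.one_lt hn

/-- The partial sums of the series of `-log (1 - z)`. -/
lemma norm_sum_pow_div_add_log_one_sub_le (n : ℕ) {z : ℂ} (hz : ‖z‖ < 1) :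
    ‖∑ k ∈ Finset.Icc 1 n, z ^ k / k + Complex.log (1 - z)‖ ≤
      ‖z‖ ^ (n + 1) * (1 - ‖z‖)⁻¹ / (n + 1) := by
  have h := norm_log_sub_logTaylor_le n (z := -z) (by rwa [norm_neg])
  rw [norm_neg, ← sub_eq_add_neg] at h
  have e : logTaylor (n + 1) (-z) = -∑ k ∈ Finset.Icc 1 n, z ^ k / k := by
    rw [logTaylor, Finset.sum_range_succ', ← Finset.sum_neg_distrib,
      Finset.range_eq_Ico, Finset.sum_Ico_add' (fun k : ℕ => (-1) ^ (k + 1) * (-z) ^ k / (k : ℂ))]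
    simp only [Nat.cast_zero, div_zero, add_zero, zero_add]
    refine Finset.sum_congr rfl fun k _ => ?_
    rw [neg_pow z, pow_succ, ← neg_div]
    congr 1
    have : ((-1 : ℂ) ^ k) * (-1) ^ k = 1 := by rw [← mul_pow]; simp
    linear_combination (-z ^ k) * this
  rwa [e, sub_neg_eq_add, add_comm] at h

/-- A Chebyshev-type bound for the tail of `∑ log p / p ^ 2`. -/
lemma sum_prime_log_div_sq_le {M : ℕ} (hM : 1 ≤ M) (N : ℕ) :
    ∑ p ∈ (Finset.Ioc M N).filter Nat.Prime, Real.log p / (p : ℝ) ^ 2 ≤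
      2 * Real.log 4 / M := by
  have hL : 0 < Real.log 4 := Real.log_pos (by norm_num)
  rcases le_total N M with h | h
  · rw [Finset.Ioc_eq_empty_of_le h]
    simp only [filter_empty, sum_empty]
    positivity
  suffices H : ∑ p ∈ (Finset.Ioc M N).filter Nat.Prime, Real.log p / (p : ℝ) ^ 2 ≤
      Chebyshev.theta N / (N : ℝ) ^ 2 + 2 * Real.log 4 * (1 / M - 1 / N) by
    have hN : (0 : ℝ) < N := by exact_mod_cast hM.trans h
    have ht : Chebyshev.theta N / (N : ℝ) ^ 2 ≤ Real.log 4 / N := by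
      rw [div_le_div_iff₀ (by positivity) hN]
      nlinarith [Chebyshev.theta_le_log4_mul_x hN.le]
    have : 0 ≤ Real.log 4 / N := by positivity
    calc _ ≤ _ := H
      _ ≤ Real.log 4 / N + 2 * Real.log 4 * (1 / M - 1 / N) := by gcongr
      _ = 2 * Real.log 4 / M - Real.log 4 / N := by ring
      _ ≤ _ := by linarith
  induction N, h using Nat.le_induction with
  | base => simpa using div_nonneg (Chebyshev.theta_nonneg M) (by positivity)
  | succ N hN ih =>
    have hN0 : (0 : ℝ) < N := by exact_mod_cast hM.trans hN
    have hθ : Chebyshev.theta ((N + 1 : ℕ) : ℝ) = Chebyshev.theta N +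
        if (N + 1).Prime then Real.log (N + 1 : ℕ) else 0 := by
      simp only [Chebyshev.theta, Nat.floor_natCast, sum_filter]
      rw [Finset.sum_Ioc_succ_top (by lia)]
    have hS : ∑ p ∈ (Finset.Ioc M (N + 1)).filter Nat.Prime, Real.log p / (p : ℝ) ^ 2 =
        ∑ p ∈ (Finset.Ioc M N).filter Nat.Prime, Real.log p / (p : ℝ) ^ 2 +
        (if (N + 1).Prime then Real.log (N + 1 : ℕ) else 0) / ((N + 1 : ℕ) : ℝ) ^ 2 := by
      simp only [sum_filter]
      rw [Finset.sum_Ioc_succ_top hN]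
      split_ifs <;> simp
    rw [hS, hθ, add_div]
    have key : Chebyshev.theta N / (N : ℝ) ^ 2 - Chebyshev.theta N / ((N + 1 : ℕ) : ℝ) ^ 2 ≤
        2 * Real.log 4 * (1 / N - 1 / ((N + 1 : ℕ) : ℝ)) := by
      have e1 : Chebyshev.theta N / (N : ℝ) ^ 2 - Chebyshev.theta N / ((N + 1 : ℕ) : ℝ) ^ 2 =
          Chebyshev.theta N * ((2 * N + 1) / ((N : ℝ) ^ 2 * (N + 1) ^ 2)) := by
        push_cast; field_simp; ring
      have e2 : 2 * Real.log 4 * (1 / N - 1 / ((N + 1 : ℕ) : ℝ)) =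
          Real.log 4 * N * ((2 * N + 2) / ((N : ℝ) ^ 2 * (N + 1) ^ 2)) := by
        push_cast; field_simp; ring
      rw [e1, e2]
      gcongr
      · exact Chebyshev.theta_le_log4_mul_x hN0.le
      · norm_num
    linarith

/-- The terms with `p ^ k > N` missing from the expansion of `-log (1 - z)`, when `|z| ≤ 1 / p`. -/
lemma norm_sum_pow_div_add_log_one_sub_le_of_prime {p : ℕ} (hp : p.Prime) {x : ℝ} (hx : 2 ≤ x)
    (hpx : p ≤ ⌊x⌋₊) {z : ℂ} (hz : ‖z‖ ≤ 1 / p) :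
    ‖∑ k ∈ Finset.Icc 1 (Nat.log p ⌊x⌋₊), z ^ k / k + Complex.log (1 - z)‖ ≤
        2 / Real.log x * (Real.log p / x) ∧
      ‖∑ k ∈ Finset.Icc 1 (Nat.log p ⌊x⌋₊), z ^ k / k + Complex.log (1 - z)‖ ≤
        2 / Real.log x * (Real.log p / (p : ℝ) ^ 2) := by
  have hp2 : (2 : ℝ) ≤ p := by exact_mod_cast hp.two_le
  have hp0 : (0 : ℝ) < p := by linarith
  have hz2 : ‖z‖ ≤ 1 / 2 := hz.trans (by gcongr)
  have hlx : 0 < Real.log x := Real.log_pos (by linarith)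
  have hlp : 0 < Real.log p := Real.log_pos (by linarith)
  set m := Nat.log p ⌊x⌋₊
  have hm1 : 1 ≤ m := Nat.log_pos hp.one_lt hpx
  have hxp : x ≤ (p : ℝ) ^ (m + 1) := by
    have h1 : ⌊x⌋₊ + 1 ≤ p ^ (m + 1) := Nat.lt_pow_succ_log_self hp.one_lt _
    have h2 : (⌊x⌋₊ : ℝ) + 1 ≤ (p : ℝ) ^ (m + 1) := by exact_mod_cast h1
    exact (Nat.lt_floor_add_one x).le.trans h2
  have hsq : (p : ℝ) ^ 2 ≤ (p : ℝ) ^ (m + 1) := by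
    gcongr
    · linarith
    · lia
  have hlog : Real.log x ≤ (m + 1) * Real.log p := by
    have := Real.log_le_log (by linarith) hxp
    rwa [Real.log_pow, Nat.cast_add, Nat.cast_one] at this
  have hm0 : (0 : ℝ) < m + 1 := by positivity
  have hb : ‖∑ k ∈ Finset.Icc 1 m, z ^ k / k + Complex.log (1 - z)‖ ≤
      2 / Real.log x * (Real.log p / (p : ℝ) ^ (m + 1)) := by
    calc _ ≤ ‖z‖ ^ (m + 1) * (1 - ‖z‖)⁻¹ / (m + 1) :=
          norm_sum_pow_div_add_log_one_sub_le m (by linarith)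
      _ ≤ (1 / p) ^ (m + 1) * (1 - 1 / 2)⁻¹ / (m + 1) := by
          gcongr
          exact inv_nonneg.mpr (by linarith)
      _ = 2 / (p : ℝ) ^ (m + 1) * (1 / (m + 1)) := by rw [div_pow, one_pow]; ring
      _ ≤ 2 / (p : ℝ) ^ (m + 1) * (Real.log p / Real.log x) := by
          gcongr ?_ * ?_
          rw [div_le_div_iff₀ hm0 hlx]
          linarith
      _ = _ := by ring
  exact ⟨hb.trans (by gcongr), hb.trans (by gcongr)⟩

/-- For a completely multiplicative `a : ℕ → ℂ` with `|a(p)| ≤ 1`, `x ≥ 2` and `Re s ≥ 1`,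
`∑_{1 < n ≤ x} Λ(n) a(n) / (n^s log n) = ∑_{p ≤ x} log(1 − a(p)/p^s)⁻¹ + O(1/(√x log x))`. -/
theorem log_sum_approx :
    ∃ C : ℝ, 0 < C ∧
      ∀ a : ℕ → ℂ, a 1 = 1 → (∀ m n : ℕ, a (m * n) = a m * a n) →
        (∀ p : ℕ, p.Prime → ‖a p‖ ≤ 1) →
        ∀ x : ℝ, 2 ≤ x → ∀ s : ℂ, 1 ≤ s.re →
          ‖(∑ n ∈ Finset.Ioc 1 ⌊x⌋₊,
                (ArithmeticFunction.vonMangoldt n : ℂ) * a n /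
                  ((n : ℂ) ^ s * (Real.log n : ℂ))) -
              ∑ p ∈ (Finset.Icc 1 ⌊x⌋₊).filter Nat.Prime,
                (-Complex.log (1 - a p / (p : ℂ) ^ s))‖ ≤
            C / (Real.sqrt x * Real.log x) := by
  have hL : 0 < Real.log 4 := Real.log_pos (by norm_num)
  refine ⟨10 * Real.log 4, by positivity, fun a ha1 hmul ha x hx s hs => ?_⟩
  have hpow (p k : ℕ) : a (p ^ k) = a p ^ k := by
    induction k with
    | zero => simpa using ha1
    | succ k ih => rw [pow_succ, hmul, ih, pow_succ]
  have hx0 : 0 < x := by linarith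
  have hlx : 0 < Real.log x := Real.log_pos (by linarith)
  have hterm {p k : ℕ} (hp : p.Prime) (hk : k ≠ 0) :
      (ArithmeticFunction.vonMangoldt (p ^ k) : ℂ) * a (p ^ k) /
        (((p ^ k : ℕ) : ℂ) ^ s * (Real.log (p ^ k : ℕ) : ℂ)) = (a p / (p : ℂ) ^ s) ^ k / k := by
    have hlp : (Real.log p : ℂ) ≠ 0 :=
      ofReal_ne_zero.mpr (Real.log_pos (by exact_mod_cast hp.one_lt)).ne'
    have hk' : (k : ℂ) ≠ 0 := by exact_mod_cast hk
    have hps : (p : ℂ) ^ s ≠ 0 := by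
      rw [Ne, cpow_eq_zero_iff]; simp [hp.ne_zero]
    have hcpow : ((p ^ k : ℕ) : ℂ) ^ s = ((p : ℂ) ^ s) ^ k := by
      rw [Nat.cast_pow, ← natCast_cpow_natCast_mul, ← cpow_nat_mul, mul_comm]
    rw [vonMangoldt_apply_pow hk, vonMangoldt_apply_prime hp, hpow, hcpow, Nat.cast_pow,
      Real.log_pow, ofReal_mul, ofReal_natCast, div_pow]
    field_simp
  have hz {p : ℕ} (hp : p.Prime) : ‖a p / (p : ℂ) ^ s‖ ≤ 1 / p := by
    rw [norm_div, norm_natCast_cpow_of_pos hp.pos]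
    have hp1 : (1 : ℝ) ≤ p := by exact_mod_cast hp.one_le
    gcongr
    · exact ha p hp
    · simpa using Real.rpow_le_rpow_of_exponent_le hp1 hs
  have hsum : ∑ n ∈ Finset.Ioc 1 ⌊x⌋₊, (ArithmeticFunction.vonMangoldt n : ℂ) * a n /
      ((n : ℂ) ^ s * (Real.log n : ℂ)) = ∑ p ∈ (Finset.Icc 1 ⌊x⌋₊).filter Nat.Prime,
        ∑ k ∈ Finset.Icc 1 (Nat.log p ⌊x⌋₊), (a p / (p : ℂ) ^ s) ^ k / k := by
    rw [← Finset.sum_filter_of_ne (p := IsPrimePow) fun n _ h => vonMangoldt_ne_zero_iff.mp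
      fun h0 => h (by simp [h0]), sum_primePow_eq_sum_prime_sum_exponent]
    refine Finset.sum_congr rfl fun p hp => Finset.sum_congr rfl fun k hk => ?_
    exact hterm (mem_filter.mp hp).2 (by have := mem_Icc.mp hk; lia)
  rw [hsum, ← Finset.sum_sub_distrib]
  simp only [sub_neg_eq_add]
  have hsx : 0 < √x := Real.sqrt_pos.mpr hx0
  have hs1 : 1 ≤ √x := Real.one_le_sqrt.mpr (by linarith)
  set M := ⌊√x⌋₊
  have hM1 : 1 ≤ M := Nat.le_floor (by simpa using hs1)
  have hMx : M ≤ ⌊x⌋₊ := Nat.floor_le_floor (Real.sqrt_le_iff.mpr ⟨hx0.le, by nlinarith⟩)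
  have hMs : √x / 2 ≤ M := by
    have h1 := Nat.lt_floor_add_one √x
    have h2 : (1 : ℝ) ≤ M := by exact_mod_cast hM1
    linarith
  have hsplit : (Finset.Icc 1 ⌊x⌋₊).filter Nat.Prime =
      (Finset.Ioc 0 M).filter Nat.Prime ∪ (Finset.Ioc M ⌊x⌋₊).filter Nat.Prime := by
    rw [← filter_union, Finset.Ioc_union_Ioc_eq_Ioc (Nat.zero_le _) hMx]
    rfl
  have hdisj : Disjoint ((Finset.Ioc 0 M).filter Nat.Prime)
      ((Finset.Ioc M ⌊x⌋₊).filter Nat.Prime) :=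
    Finset.disjoint_filter_filter (Finset.Ioc_disjoint_Ioc_of_le le_rfl)
  rw [hsplit, Finset.sum_union hdisj]
  have hsmall : ∑ p ∈ (Finset.Ioc 0 M).filter Nat.Prime, Real.log p / x ≤ Real.log 4 / √x := by
    rw [← Finset.sum_div]
    have := Chebyshev.theta_le_log4_mul_x hsx.le
    calc _ ≤ Real.log 4 * √x / x := by gcongr; exact this
      _ = _ := by
        rw [div_eq_div_iff hx0.ne' hsx.ne', mul_assoc, Real.mul_self_sqrt hx0.le]
  have hlarge : ∑ p ∈ (Finset.Ioc M ⌊x⌋₊).filter Nat.Prime, Real.log p / (p : ℝ) ^ 2 ≤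
      4 * Real.log 4 / √x := by
    calc _ ≤ 2 * Real.log 4 / M := sum_prime_log_div_sq_le hM1 _
      _ ≤ 2 * Real.log 4 / (√x / 2) := by gcongr
      _ = _ := by ring
  calc _ ≤ 2 / Real.log x * ∑ p ∈ (Finset.Ioc 0 M).filter Nat.Prime, Real.log p / x +
        2 / Real.log x * ∑ p ∈ (Finset.Ioc M ⌊x⌋₊).filter Nat.Prime,
          Real.log p / (p : ℝ) ^ 2 := by
        rw [Finset.mul_sum, Finset.mul_sum]
        refine norm_add_le_of_le (norm_sum_le_of_le _ fun p h => ?_)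
          (norm_sum_le_of_le _ fun p h => ?_) <;>
        obtain ⟨h, hp⟩ := mem_filter.mp h <;> rw [mem_Ioc] at h
        · exact (norm_sum_pow_div_add_log_one_sub_le_of_prime hp hx (h.2.trans hMx) (hz hp)).1
        · exact (norm_sum_pow_div_add_log_one_sub_le_of_prime hp hx h.2 (hz hp)).2
    _ ≤ 2 / Real.log x * (Real.log 4 / √x) + 2 / Real.log x * (4 * Real.log 4 / √x) := by
        gcongr
    _ = _ := by field_simp; ring
end
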